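/- arXiv:1903.07921 — 2 statements merged into one kernel-verified Lean document; each statement's English description precedes it below -/
import Mathlib

section
/- Let A and B be finite-dimensional algebras over a field k, M a Frobenius B-A-bimodule, and N = Hom_B(M,B) the associated A-B-bimodule. If M is faithful as a right A-module, then for every finitely generated B-module Y with add(Y) = B-stp one has A-stp = add(N ⊗_B Y). Dually, if M is faithful as a left B-module, then for every finitely generated A-module X with add(X) = A-stp one has B-stp = add(M ⊗_A X). -/
/-!
Statement 6: Let `A`, `B` be finite-dimensional algebras over a field `k`, `M` a Frobenius
`B`-`A`-bimodule and `N = Hom_B(M, B)`.  If `M` is faithful as a right `A`-module then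
`A`-stp `= add(N ⊗_B Y)` for every finitely generated `B`-module `Y` with `add(Y) = B`-stp;
dually, if `M` is faithful as a left `B`-module then `B`-stp `= add(M ⊗_A X)` for every
finitely generated `A`-module `X` with `add(X) = A`-stp.
-/

universe u
open MulOpposite
section FrobeniusBimodule

variable (S R M : Type u) [Ring S] [Ring R] [AddCommGroup M]
  [Module S M] [Module Rᵐᵒᵖ M] [SMulCommClass S Rᵐᵒᵖ M] [SMulCommClass Rᵐᵒᵖ S M]

/-- The right action of `r : R` on the `S`-`R`-bimodule `M`, as an `S`-linear map. -/
def ract (r : R) : M →ₗ[S] M where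
  toFun m := op r • m
  map_add' _ _ := smul_add _ _ _
  map_smul' s m := smul_comm (op r) s m

/-- The left action of `s : S` on the `S`-`R`-bimodule `M`, as a right `R`-linear map. -/
def lact (s : S) : M →ₗ[Rᵐᵒᵖ] M where
  toFun m := s • m
  map_add' _ _ := smul_add _ _ _
  map_smul' r m := smul_comm s r m

/-- Left multiplication by `r : R` on `R`, as a right `R`-linear map. -/
def mulLeft' (r : R) : R →ₗ[Rᵐᵒᵖ] R where
  toFun x := r * x
  map_add' := mul_add r
  map_smul' a x := by
    simp only [MulOpposite.smul_eq_mul_unop, RingHom.id_apply, mul_assoc]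

/-- An `S`-`R`-bimodule `M` is a Frobenius bimodule if it is finitely generated projective
as a left `S`-module and as a right `R`-module, and `Hom_S(M, S) ≅ Hom_{Rᵒᵖ}(M, R)` as
`R`-`S`-bimodules.  Here `Hom_S(M, S)` is an `R`-`S`-bimodule via `(r • f • s) m = f (m r) s`,
and `Hom_{Rᵒᵖ}(M, R)` is an `R`-`S`-bimodule via `(r • g • s) m = r * g (s • m)`; the
bimodule conditions on the additive isomorphism `e` are stated via the two compatibilities
below. -/
def IsFrobeniusBimodule : Prop :=
  Module.Finite S M ∧ Module.Projective S M ∧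
  Module.Finite Rᵐᵒᵖ M ∧ Module.Projective Rᵐᵒᵖ M ∧
  ∃ e : (M →ₗ[S] S) ≃+ (M →ₗ[Rᵐᵒᵖ] R),
    (∀ (r : R) (f : M →ₗ[S] S), e (f ∘ₗ ract S R M r) = mulLeft' R r ∘ₗ e f) ∧
    (∀ (s : S) (f : M →ₗ[S] S),
      e (LinearMap.toSpanSingleton S S s ∘ₗ f) = e f ∘ₗ lact S R M s)

variable (Y : Type u) [AddCommGroup Y] [Module S Y]

/-- `Hom_S(M, Y)` is a left `R`-module via the right action of `R` on `M`:
`(r • f) m = f (m r)`. -/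
instance homLeftModule : Module R (M →ₗ[S] Y) where
  smul r f := f ∘ₗ ract S R M r
  one_smul f := by ext m; show f _ = f m; simp [ract]
  mul_smul r r' f := by ext m; show f _ = f _; simp [ract, op_mul, mul_smul]
  smul_zero r := rfl
  smul_add r f g := rfl
  add_smul r r' f := by ext m; show f _ = f _ + f _; simp [ract, op_add, add_smul, map_add]
  zero_smul f := by ext m; show f _ = 0; simp [ract]

/-- The left `R`-action on `Hom_S(M, Y)` through the domain commutes with any compatible
action on the codomain. -/
instance homActionsComm (T : Type u) [Ring T] [Module T Y] [SMulCommClass S T Y] :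
    SMulCommClass T R (M →ₗ[S] Y) :=
  ⟨fun _ _ _ => rfl⟩

end FrobeniusBimodule
section NCTensor

variable (R : Type u) [Ring R] (M : Type u) [AddCommGroup M] [Module Rᵐᵒᵖ M]
  (X : Type u) [AddCommGroup X] [Module R X]
  (S : Type u) [Ring S] [Module S M] [SMulCommClass Rᵐᵒᵖ S M]

/-- The submodule of balanced relations in `M ⊗[ℤ] X`, where `M` is an `S`-`R`-bimodule
and `X` a left `R`-module.  Since the generating set is stable under the action of `S`,
its `S`-span coincides with its additive span. -/
def balS : Submodule S (TensorProduct ℤ M X) :=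
  Submodule.span S
    {z | ∃ (m : M) (r : R) (x : X), z = m ⊗ₜ[ℤ] (r • x) - ((op r) • m) ⊗ₜ[ℤ] x}

/-- The tensor product `M ⊗_R X` over the (possibly noncommutative) ring `R`, for a right
`R`-module `M` and a left `R`-module `X`: the quotient of `M ⊗[ℤ] X` by the balanced
relations.  When `M` is an `S`-`R`-bimodule this is a left `S`-module. -/
def NCT := (TensorProduct ℤ M X) ⧸ balS R M X S

noncomputable instance : AddCommGroup (NCT R M X S) :=
  inferInstanceAs (AddCommGroup ((TensorProduct ℤ M X) ⧸ balS R M X S))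

noncomputable instance : Module S (NCT R M X S) :=
  inferInstanceAs (Module S ((TensorProduct ℤ M X) ⧸ balS R M X S))

/-- The class of the pure tensor `m ⊗ x` in `M ⊗_R X`. -/
noncomputable def mkT (m : M) (x : X) : NCT R M X S :=
  Submodule.Quotient.mk (m ⊗ₜ[ℤ] x)

end NCTensor
section Nakayama

variable (k : Type u) [Field k] (A : Type u) [Ring A] [Algebra k A]

/-- The Nakayama functor `ν_A = D Hom_A(-, A)` on (the objects of) the category of left
`A`-modules, where `D = Hom_k(-, k)` is the `k`-dual: `Hom_A(X, A)` is a right `A`-module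
via right multiplication on `A`, and its `k`-dual is a left `A`-module. -/
noncomputable def nak (X : ModuleCat.{u} A) : ModuleCat.{u} A :=
  ModuleCat.of A ((↑X →ₗ[A] A) →ₗ[k] k)

/-- A finitely generated projective `A`-module `P` is `ν`-stably projective if `ν_A^i P` is
projective for all `i > 0`. -/
noncomputable def IsStp (P : ModuleCat.{u} A) : Prop :=
  Module.Finite A P ∧ Module.Projective A P ∧
    ∀ i : ℕ, 0 < i → Module.Projective A ((nak k A)^[i] P)

/-- `Y` belongs to `add X`: `Y` is a direct summand of a finite direct sum of copies
of `X`. -/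
def InAdd (X Y : ModuleCat.{u} A) : Prop :=
  ∃ (n : ℕ) (f : Y →ₗ[A] (Fin n → X)) (g : (Fin n → X) →ₗ[A] Y),
    g ∘ₗ f = LinearMap.id

end Nakayama

section SumFactorization

/-- `Y` is a direct summand of a finite direct sum of copies of `X`, expressed by a finite sum of
endomorphisms of `Y` factoring through `X` that equals the identity. -/
def SumFactor (A : Type*) [Ring A] (X Y : Type*) [AddCommGroup X] [Module A X] [AddCommGroup Y]
    [Module A Y] : Prop :=
  ∃ (n : ℕ) (f : Fin n → Y →ₗ[A] X) (g : Fin n → X →ₗ[A] Y), ∑ i, g i ∘ₗ f i = LinearMap.id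

variable {A : Type*} [Ring A] {X Y Z : Type*} [AddCommGroup X] [Module A X] [AddCommGroup Y]
    [Module A Y] [AddCommGroup Z] [Module A Z]

theorem SumFactor.of_fintype {ι : Type*} [Fintype ι] (f : ι → Y →ₗ[A] X) (g : ι → X →ₗ[A] Y)
    (h : ∑ i, g i ∘ₗ f i = LinearMap.id) : SumFactor A X Y := by
  refine ⟨Fintype.card ι, fun i => f ((Fintype.equivFin ι).symm i),
    fun i => g ((Fintype.equivFin ι).symm i), ?_⟩
  rw [← h]
  exact Equiv.sum_comp (Fintype.equivFin ι).symm fun i => g i ∘ₗ f i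

theorem SumFactor.of_comp_eq_id (f : Y →ₗ[A] X) (g : X →ₗ[A] Y) (h : g ∘ₗ f = LinearMap.id) :
    SumFactor A X Y :=
  ⟨1, fun _ => f, fun _ => g, by simpa using h⟩

theorem SumFactor.trans (h₁ : SumFactor A X Y) (h₂ : SumFactor A Y Z) : SumFactor A X Z := by
  obtain ⟨n, f, g, h⟩ := h₁
  obtain ⟨m, f', g', h'⟩ := h₂
  refine SumFactor.of_fintype (ι := Fin m × Fin n) (fun i => f i.2 ∘ₗ f' i.1)
    (fun i => g' i.1 ∘ₗ g i.2) ?_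
  rw [Fintype.sum_prod_type, ← h']
  refine Finset.sum_congr rfl fun i _ => ?_
  ext z
  have := LinearMap.congr_fun h (f' i z)
  simp only [LinearMap.sum_apply, LinearMap.comp_apply, LinearMap.id_apply] at this ⊢
  rw [← map_sum, this]

theorem SumFactor.finite_projective (h : SumFactor A X Y) [Module.Finite A X]
    [Module.Projective A X] : Module.Finite A Y ∧ Module.Projective A Y := by
  obtain ⟨n, f, g, h⟩ := h
  have hs : (LinearMap.lsum A (fun _ : Fin n => X) ℕ g) ∘ₗ LinearMap.pi f = LinearMap.id := by
    rw [← h]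
    ext y
    simp
  have : Module.Projective A (Fin n → X) :=
    Module.Projective.of_equiv (DFinsupp.linearEquivFunOnFintype (R := A) (M := fun _ : Fin n => X))
  refine ⟨Module.Finite.of_surjective (LinearMap.lsum A (fun _ : Fin n => X) ℕ g) fun y =>
    ⟨LinearMap.pi f y, LinearMap.congr_fun hs y⟩, Module.Projective.of_split _ _ hs⟩

theorem inAdd_iff_sumFactor {A : Type u} [Ring A] (X Y : ModuleCat.{u} A) :
    InAdd A X Y ↔ SumFactor A X Y := by
  constructor
  · rintro ⟨n, f, g, h⟩
    refine ⟨n, fun i => LinearMap.proj i ∘ₗ f, fun i => g ∘ₗ LinearMap.single A (fun _ : Fin n => X) i, ?_⟩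
    rw [← h]
    ext y
    simp only [LinearMap.sum_apply, LinearMap.comp_apply, LinearMap.proj_apply, ← map_sum]
    congr 1
    exact Finset.univ_sum_single (f y)
  · rintro ⟨n, f, g, h⟩
    refine ⟨n, LinearMap.pi f, LinearMap.lsum A (fun _ : Fin n => X) ℕ g, ?_⟩
    rw [← h]
    ext y
    simp

/-- A finite dual basis of a finitely generated projective module. -/
theorem exists_finite_dual_basis (A : Type*) [Ring A] (P : Type*) [AddCommGroup P] [Module A P]
    [Module.Finite A P] [Module.Projective A P] :
    ∃ (n : ℕ) (x : Fin n → P) (φ : Fin n → P →ₗ[A] A), ∀ p, ∑ i, φ i p • x i = p := by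
  obtain ⟨n, f, g, -, -, h⟩ := Module.Finite.exists_comp_eq_id_of_projective A P
  refine ⟨n, fun i => f (Pi.single i 1), fun i => LinearMap.proj i ∘ₗ g, fun p => ?_⟩
  conv_rhs => rw [← LinearMap.id_apply (R := A) p, ← h, LinearMap.comp_apply,
    pi_eq_sum_univ' (g p), map_sum]
  refine Finset.sum_congr rfl fun i _ => ?_
  rw [map_smul]
  simp only [LinearMap.comp_apply, LinearMap.proj_apply]

theorem eq_zero_of_forall_dual_eq_zero [Module.Finite A X] [Module.Projective A X] {x : X}
    (h : ∀ φ : X →ₗ[A] A, φ x = 0) : x = 0 := by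
  obtain ⟨n, y, φ, hφ⟩ := exists_finite_dual_basis A X
  rw [← hφ x]
  simp [h]

/-- A finitely generated projective module that is the sum of the images of a family of maps
decomposes its identity through finitely many members of the family. -/
theorem exists_finset_sum_comp_eq_id {ι : Type*} {W : ι → Type*} [∀ i, AddCommGroup (W i)]
    [∀ i, Module A (W i)] [Module.Finite A X] [Module.Projective A X] (h : ∀ i, W i →ₗ[A] X)
    (hh : ⨆ i, LinearMap.range (h i) = ⊤) :
    ∃ (s : Finset ι) (f : ∀ i, X →ₗ[A] W i), ∑ i ∈ s, h i ∘ₗ f i = LinearMap.id := by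
  classical
  have hs : Function.Surjective (DFinsupp.lsum ℕ h) := by
    rw [← LinearMap.range_eq_top, eq_top_iff, ← hh]
    refine iSup_le fun i => ?_
    rintro _ ⟨w, rfl⟩
    exact ⟨DFinsupp.single i w, by simp⟩
  obtain ⟨σ, hσ⟩ := Module.projective_lifting_property _ (LinearMap.id : X →ₗ[A] X) hs
  obtain ⟨n, x, φ, hφ⟩ := exists_finite_dual_basis A X
  refine ⟨Finset.univ.biUnion fun i => (σ (x i)).support, fun i => DFinsupp.lapply i ∘ₗ σ, ?_⟩
  have key : ∀ j, ∑ i ∈ Finset.univ.biUnion fun i => (σ (x i)).support, h i (σ (x j) i) = x j := by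
    intro j
    have := LinearMap.congr_fun hσ (x j)
    rw [LinearMap.comp_apply, LinearMap.id_apply, DFinsupp.lsum_apply_apply,
      DFinsupp.sumAddHom_apply, DFinsupp.sum] at this
    conv_rhs => rw [← this]
    symm
    refine Finset.sum_subset (Finset.subset_biUnion_of_mem (fun i => (σ (x i)).support)
      (Finset.mem_univ j)) fun i _ hi => ?_
    simp only [DFinsupp.mem_support_toFun, not_not] at hi
    simp [hi]
  ext p
  rw [← hφ p, map_sum, map_sum]
  refine Finset.sum_congr rfl fun j _ => ?_
  rw [map_smul, map_smul, LinearMap.id_apply]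
  congr 1
  simpa [LinearMap.sum_apply] using key j

end SumFactorization
section NakayamaModule

variable (k : Type u) [Field k] {A : Type u} [Ring A] [Algebra k A]
  {X Y Z P Q : Type u} [AddCommGroup X] [Module A X] [AddCommGroup Y] [Module A Y]
  [AddCommGroup Z] [Module A Z] [AddCommGroup P] [Module A P] [AddCommGroup Q] [Module A Q]

/-- The carrier of `nak`, for unbundled modules. -/
abbrev NakMod (A : Type u) [Ring A] [Algebra k A] (X : Type u) [AddCommGroup X] [Module A X] :
    Type u :=
  (X →ₗ[A] A) →ₗ[k] k

theorem nakMod_smul_apply (a : A) (l : NakMod k A X) (φ : X →ₗ[A] A) :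
    (a • l) φ = l (LinearMap.toSpanSingleton A A a ∘ₗ φ) :=
  rfl

theorem algebraMap_smul_nakMod (c : k) (l : NakMod k A X) : algebraMap k A c • l = c • l := by
  ext φ
  rw [nakMod_smul_apply, LinearMap.smul_apply, ← map_smul]
  congr 1
  ext x
  simp [Algebra.smul_def, Algebra.commutes]

/-- The action of the Nakayama functor on morphisms. -/
def nakMap (f : X →ₗ[A] Y) : NakMod k A X →ₗ[A] NakMod k A Y where
  toFun l :=
    { toFun := fun φ => l (φ ∘ₗ f)
      map_add' := fun φ ψ => by rw [LinearMap.add_comp, map_add]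
      map_smul' := fun c φ => by rw [LinearMap.smul_comp, map_smul, RingHom.id_apply] }
  map_add' _ _ := rfl
  map_smul' _ _ := rfl

theorem nakMap_apply (f : X →ₗ[A] Y) (l : NakMod k A X) (φ : Y →ₗ[A] A) :
    nakMap k f l φ = l (φ ∘ₗ f) :=
  rfl

theorem nakMap_id : nakMap k (LinearMap.id : X →ₗ[A] X) = LinearMap.id :=
  rfl

theorem nakMap_comp (g : Y →ₗ[A] Z) (f : X →ₗ[A] Y) :
    nakMap k (g ∘ₗ f) = nakMap k g ∘ₗ nakMap k f :=
  rfl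

theorem nakMap_sum {ι : Type*} (s : Finset ι) (f : ι → X →ₗ[A] Y) :
    nakMap k (∑ i ∈ s, f i) = ∑ i ∈ s, nakMap k (f i) := by
  ext l φ
  have : φ ∘ₗ ∑ i ∈ s, f i = ∑ i ∈ s, φ ∘ₗ f i := by
    ext x
    simp [LinearMap.sum_apply]
  simp only [nakMap_apply, this, map_sum, LinearMap.sum_apply]

theorem SumFactor.nakMod (h : SumFactor A X Y) : SumFactor A (NakMod k A X) (NakMod k A Y) := by
  obtain ⟨n, f, g, h⟩ := h
  refine ⟨n, fun i => nakMap k (f i), fun i => nakMap k (g i), ?_⟩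
  simp only [← nakMap_comp]
  rw [← nakMap_sum, h, nakMap_id]

theorem nakMap_injective [Module.Finite A Q] [Module.Projective A Q] :
    Function.Injective (nakMap k : (P →ₗ[A] Q) → _) := by
  intro f g h
  ext p
  rw [← sub_eq_zero]
  refine eq_zero_of_forall_dual_eq_zero (A := A) fun φ => ?_
  have : φ ∘ₗ f = φ ∘ₗ g := by
    rw [← sub_eq_zero, ← Module.forall_dual_apply_eq_zero_iff k]
    intro l
    rw [map_sub, sub_eq_zero]
    exact LinearMap.congr_fun (LinearMap.congr_fun h l) φ
  rw [map_sub, sub_eq_zero]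
  exact LinearMap.congr_fun this p

theorem finite_dual [FiniteDimensional k A] [Module.Finite A P] :
    Module.Finite k (P →ₗ[A] A) := by
  obtain ⟨n, g, hg⟩ := Module.Finite.exists_fin' A P
  let r : (P →ₗ[A] A) →ₗ[k] (Fin n → A) :=
    { toFun := fun φ i => φ (g (Pi.single i 1))
      map_add' := fun _ _ => rfl
      map_smul' := fun _ _ => rfl }
  refine Module.Finite.of_injective r fun φ ψ h => ?_
  have : φ ∘ₗ g = ψ ∘ₗ g := by
    refine LinearMap.pi_ext' fun i => LinearMap.ext_ring ?_
    exact congr_fun h i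
  ext p
  obtain ⟨x, rfl⟩ := hg p
  exact LinearMap.congr_fun this x

theorem finite_nakMod [FiniteDimensional k A] [Module.Finite A P] :
    Module.Finite A (NakMod k A P) := by
  have := finite_dual k (A := A) (P := P)
  have : IsScalarTower k A (NakMod k A P) :=
    IsScalarTower.of_algebraMap_smul (algebraMap_smul_nakMod k)
  exact Module.Finite.of_restrictScalars_finite k A _

theorem dual_eq_sum {n : ℕ} {x : Fin n → P} {φ : Fin n → P →ₗ[A] A}
    (h : ∀ p, ∑ i, φ i p • x i = p) (ψ : P →ₗ[A] A) :
    ψ = ∑ i, LinearMap.toSpanSingleton A A (ψ (x i)) ∘ₗ φ i := by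
  ext p
  conv_lhs => rw [← h p, map_sum]
  simp [LinearMap.sum_apply]

theorem exists_nakMap_eq [FiniteDimensional k A] [Module.Finite A P]
    [Module.Finite A Q] [Module.Projective A Q] (h : NakMod k A P →ₗ[A] NakMod k A Q) :
    ∃ f : P →ₗ[A] Q, nakMap k f = h := by
  have := finite_dual k (A := A) (P := P)
  have ex : ∀ φ : Q →ₗ[A] A, ∃ ψ : P →ₗ[A] A, ∀ l, h l φ = l ψ := by
    intro φ
    have hs : ∀ (c : k) (l : NakMod k A P), h (c • l) = c • h l := by
      intro c l
      rw [← algebraMap_smul_nakMod, map_smul, algebraMap_smul_nakMod]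
    let E : Module.Dual k (Module.Dual k (P →ₗ[A] A)) :=
      { toFun := fun l => h l φ
        map_add' := fun l l' => by rw [map_add]; rfl
        map_smul' := fun c l => by rw [hs]; rfl }
    refine ⟨(Module.evalEquiv k (P →ₗ[A] A)).symm E, fun l => ?_⟩
    exact (Module.apply_evalEquiv_symm_apply k (P →ₗ[A] A) l E).symm
  choose ψ hψ using ex
  have ψ_ext : ∀ a b : P →ₗ[A] A, (∀ l : NakMod k A P, l a = l b) → a = b := by
    intro a b hab
    rw [← sub_eq_zero, ← Module.forall_dual_apply_eq_zero_iff k]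
    intro l
    rw [map_sub, sub_eq_zero]
    exact hab l
  have ψ_sum : ∀ {n : ℕ} (φ : Fin n → Q →ₗ[A] A), ψ (∑ i, φ i) = ∑ i, ψ (φ i) := by
    intro n φ
    refine ψ_ext _ _ fun l => ?_
    rw [← hψ, map_sum, map_sum]
    exact Finset.sum_congr rfl fun i _ => hψ _ _
  have ψ_smul : ∀ (a : A) (φ : Q →ₗ[A] A), ψ (LinearMap.toSpanSingleton A A a ∘ₗ φ) =
      LinearMap.toSpanSingleton A A a ∘ₗ ψ φ := by
    intro a φ
    refine ψ_ext _ _ fun l => ?_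
    rw [← hψ, ← nakMod_smul_apply, ← nakMod_smul_apply, ← map_smul, hψ]
  obtain ⟨n, x, φ, hφ⟩ := exists_finite_dual_basis A Q
  refine ⟨∑ i, LinearMap.toSpanSingleton A Q (x i) ∘ₗ ψ (φ i), ?_⟩
  ext l η
  rw [nakMap_apply, hψ]
  congr 1
  conv_rhs => rw [dual_eq_sum hφ η, ψ_sum]
  ext p
  simp [LinearMap.sum_apply, ψ_smul]

theorem nakMod_extend [Module.Finite A P] [Module.Projective A P]
    (j : X →ₗ[A] Y) (hj : Function.Injective j) (f : X →ₗ[A] NakMod k A P) :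
    ∃ g : Y →ₗ[A] NakMod k A P, g ∘ₗ j = f := by
  obtain ⟨n, x, φ, hφ⟩ := exists_finite_dual_basis A P
  let _ := Module.compHom X (algebraMap k A)
  let _ := Module.compHom Y (algebraMap k A)
  let jk : X →ₗ[k] Y :=
    { toFun := j, map_add' := map_add j, map_smul' := fun c x => map_smul j (algebraMap k A c) x }
  obtain ⟨r, hr⟩ := jk.exists_leftInverse_of_injective (LinearMap.ker_eq_bot.2 hj)
  have hs : ∀ (c : k) (v : X), f (c • v) = c • f v := by
    intro c v
    change f (algebraMap k A c • v) = _
    rw [map_smul, algebraMap_smul_nakMod]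
  let ev : Fin n → X →ₗ[k] k := fun i =>
    { toFun := fun v => f v (φ i)
      map_add' := fun v w => by rw [map_add]; rfl
      map_smul' := fun c v => by rw [hs]; rfl }
  have hev : ∀ (v : X) (η : P →ₗ[A] A), f v η = ∑ i, ev i (η (x i) • v) := by
    intro v η
    conv_lhs => rw [dual_eq_sum hφ η, map_sum]
    refine Finset.sum_congr rfl fun i _ => ?_
    rw [← nakMod_smul_apply, ← map_smul]
    rfl
  refine ⟨
    { toFun := fun y =>
        { toFun := fun η => ∑ i, ev i (r (η (x i) • y))
          map_add' := fun η θ => by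
            simp [add_smul, Finset.sum_add_distrib]
          map_smul' := fun c η => by
            rw [RingHom.id_apply, Finset.smul_sum]
            refine Finset.sum_congr rfl fun i _ => ?_
            rw [← map_smul, ← map_smul, LinearMap.smul_apply, Algebra.smul_def, mul_smul]
            rfl }
      map_add' := fun y z => by
        ext η
        simp [Finset.sum_add_distrib]
      map_smul' := fun a y => by
        ext η
        simp [nakMod_smul_apply, mul_smul] }, ?_⟩
  ext v η
  rw [hev]
  change ∑ i, ev i (r (η (x i) • j v)) = _
  refine Finset.sum_congr rfl fun i _ => ?_
  congr 1
  rw [← map_smul]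
  exact LinearMap.congr_fun hr (η (x i) • v)

theorem hom_nakMod_eq_zero [Module.Finite A P] [Module.Projective A P]
    (hX : ∀ f : P →ₗ[A] X, f = 0) (h : X →ₗ[A] NakMod k A P) : h = 0 := by
  obtain ⟨n, x, φ, hφ⟩ := exists_finite_dual_basis A P
  ext v η
  conv_lhs => rw [dual_eq_sum hφ η, map_sum]
  refine Finset.sum_eq_zero fun i _ => ?_
  have := LinearMap.congr_fun (hX (LinearMap.toSpanSingleton A X v ∘ₗ η)) (x i)
  rw [← nakMod_smul_apply, ← map_smul]
  simp only [LinearMap.comp_apply, LinearMap.toSpanSingleton_apply, LinearMap.zero_apply] at this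
  rw [this, map_zero, LinearMap.zero_apply]

theorem hom_eq_zero_of_hom_nakMod [Module.Finite A P] [Module.Projective A P]
    (hX : ∀ h : X →ₗ[A] NakMod k A P, h = 0) (f : P →ₗ[A] X) : f = 0 := by
  obtain ⟨n, x, φ, hφ⟩ := exists_finite_dual_basis A P
  let _ := Module.compHom X (algebraMap k A)
  have : IsScalarTower k A X := IsScalarTower.of_algebraMap_smul fun _ _ => rfl
  have : SMulCommClass A k X := IsScalarTower.to_smulCommClass'
  rw [← Module.forall_dual_apply_eq_zero_iff k]
  intro l
  have hl := hX
    { toFun := fun v =>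
        { toFun := fun η => l (LinearMap.toSpanSingleton A X v ∘ₗ η)
          map_add' := fun η θ => by rw [LinearMap.comp_add, map_add]
          map_smul' := fun c η => by
            rw [RingHom.id_apply, ← map_smul]
            congr 1
            ext p
            simp }
      map_add' := fun v w => by
        ext η
        change l _ = l _ + l _
        rw [← map_add]
        congr 1
        ext p
        simp
      map_smul' := fun a v => by
        ext η
        change l _ = l _
        congr 1
        ext p
        exact (mul_smul (η p) a v).symm }
  have hf : f = ∑ i, LinearMap.toSpanSingleton A X (f (x i)) ∘ₗ φ i := by
    ext p
    conv_lhs => rw [← hφ p, map_sum]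
    simp [LinearMap.sum_apply]
  rw [hf, map_sum]
  exact Finset.sum_eq_zero fun i _ =>
    LinearMap.congr_fun (LinearMap.congr_fun hl (f (x i))) (φ i)

end NakayamaModule
section TensorHom

open CategoryTheory

variable (R : Type u) [Ring R] (M : Type u) [AddCommGroup M] [Module Rᵐᵒᵖ M]
  (X : Type u) [AddCommGroup X] [Module R X]
  (S : Type u) [Ring S] [Module S M]

theorem mkT_add_left (m m' : M) (x : X) :
    mkT R M X S (m + m') x = mkT R M X S m x + mkT R M X S m' x := by
  rw [mkT, TensorProduct.add_tmul]
  rfl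

theorem mkT_add_right (m : M) (x x' : X) :
    mkT R M X S m (x + x') = mkT R M X S m x + mkT R M X S m x' := by
  rw [mkT, TensorProduct.tmul_add]
  rfl

theorem mkT_smul_left (s : S) (m : M) (x : X) :
    mkT R M X S (s • m) x = s • mkT R M X S m x := by
  rw [mkT, ← TensorProduct.smul_tmul']
  rfl

theorem mkT_smul_right (r : R) (m : M) (x : X) :
    mkT R M X S m (r • x) = mkT R M X S (op r • m) x :=
  (Submodule.Quotient.eq _).2 (Submodule.subset_span ⟨m, r, x, rfl⟩)

/-- `mkT` as an additive map in its first argument. -/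
noncomputable def mkTLeft (x : X) : M →+ NCT R M X S where
  toFun m := mkT R M X S m x
  map_zero' := by
    have h := mkT_add_left R M X S 0 0 x
    rwa [add_zero, left_eq_add] at h
  map_add' m m' := mkT_add_left R M X S m m' x

/-- `mkT` as an additive map in its second argument. -/
noncomputable def mkTRight (m : M) : X →+ NCT R M X S where
  toFun x := mkT R M X S m x
  map_zero' := by
    have h := mkT_add_right R M X S m 0 0
    rwa [add_zero, left_eq_add] at h
  map_add' x x' := mkT_add_right R M X S m x x'

variable {R M X S} in
theorem NCT.induction_on {p : NCT R M X S → Prop} (z : NCT R M X S)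
    (h : ∀ m x, p (mkT R M X S m x)) (hadd : ∀ z w, p z → p w → p (z + w)) : p z := by
  obtain ⟨t, rfl⟩ := Submodule.Quotient.mk_surjective (balS R M X S) z
  induction t using TensorProduct.induction_on with
  | zero =>
    rw [← TensorProduct.tmul_zero (R := ℤ) X (0 : M)]
    exact h 0 0
  | tmul m x => exact h m x
  | add a b ha hb => exact hadd _ _ ha hb

variable {R M X S} in
theorem NCT.hom_ext {Z : Type*} [AddCommGroup Z] {f g : NCT R M X S →+ Z}
    (h : ∀ m x, f (mkT R M X S m x) = g (mkT R M X S m x)) : f = g := by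
  ext z
  induction z using NCT.induction_on with
  | h m x => exact h m x
  | hadd z w hz hw => rw [map_add, map_add, hz, hw]

theorem NCT.finite [Module.Finite S M] [Module.Finite R X] :
    Module.Finite S (NCT R M X S) := by
  obtain ⟨n, m, hm⟩ := Module.Finite.exists_fin (R := S) (M := M)
  obtain ⟨l, x, hx⟩ := Module.Finite.exists_fin (R := R) (M := X)
  have key : ∀ j m', mkT R M X S m' (x j) ∈
      Submodule.span S (Set.range fun p : Fin n × Fin l => mkT R M X S (m p.1) (x p.2)) := by
    intro j m'
    have hm' : m' ∈ Submodule.span S (Set.range m) := hm ▸ Submodule.mem_top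
    induction hm' using Submodule.span_induction with
    | mem y hy =>
      obtain ⟨i, rfl⟩ := hy
      exact Submodule.subset_span ⟨(i, j), rfl⟩
    | zero =>
      have h₀ : mkT R M X S 0 (x j) = 0 := map_zero (mkTLeft R M X S (x j))
      exact h₀ ▸ Submodule.zero_mem _
    | add a b _ _ ha hb => exact (mkT_add_left R M X S a b (x j)) ▸ Submodule.add_mem _ ha hb
    | smul s a _ ha => exact (mkT_smul_left R M X S s a (x j)) ▸ Submodule.smul_mem _ s ha
  refine ⟨⟨(Set.finite_range fun p : Fin n × Fin l => mkT R M X S (m p.1) (x p.2)).toFinset, ?_⟩⟩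
  rw [Set.Finite.coe_toFinset, eq_top_iff]
  rintro z -
  induction z using NCT.induction_on with
  | h m' x' =>
    have hx' : x' ∈ Submodule.span R (Set.range x) := hx ▸ Submodule.mem_top
    induction hx' using Submodule.span_induction generalizing m' with
    | mem y hy =>
      obtain ⟨j, rfl⟩ := hy
      exact key j m'
    | zero =>
      have h₀ : mkT R M X S m' 0 = 0 := map_zero (mkTRight R M X S m')
      exact h₀ ▸ Submodule.zero_mem _
    | add a b _ _ ha hb =>
      exact (mkT_add_right R M X S m' a b) ▸ Submodule.add_mem _ (ha m') (hb m')
    | smul r a _ ha => exact (mkT_smul_right R M X S r m' a) ▸ ha (op r • m')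
  | hadd z w hz hw => exact Submodule.add_mem _ hz hw

variable [SMulCommClass Rᵐᵒᵖ S M] [SMulCommClass S Rᵐᵒᵖ M] {Y : Type u} [AddCommGroup Y] [Module S Y]

/-- The map out of the tensor product determined by a family of maps. -/
noncomputable def NCT.lift (f : X →ₗ[R] (M →ₗ[S] Y)) : NCT R M X S →ₗ[S] Y :=
  (balS R M X S).liftQ
    (TensorProduct.AlgebraTensorModule.lift (R := ℤ) (A := S)
      { toFun := fun m =>
          { toFun := fun x => f x m
            map_add' := fun x y => by rw [map_add]; rfl
            map_smul' := fun c x => by rw [map_zsmul]; rfl }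
        map_add' := fun m m' => by ext x; exact map_add (f x) m m'
        map_smul' := fun s m => by ext x; exact map_smul (f x) s m })
    (by
      refine Submodule.span_le.2 ?_
      rintro _ ⟨m, r, x, rfl⟩
      change _ = _
      rw [map_sub, sub_eq_zero]
      change f (r • x) m = f x (op r • m)
      rw [map_smul]
      rfl)

/-- The curried form of a map out of the tensor product. -/
noncomputable def NCT.curry (g : NCT R M X S →ₗ[S] Y) : X →ₗ[R] (M →ₗ[S] Y) where
  toFun x :=
    { toFun := fun m => g (mkT R M X S m x)
      map_add' := fun m m' => by rw [mkT_add_left, map_add]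
      map_smul' := fun s m => by rw [mkT_smul_left, map_smul, RingHom.id_apply] }
  map_add' x x' := by
    ext m
    change g _ = g _ + g _
    rw [mkT_add_right, map_add]
  map_smul' r x := by
    ext m
    change g _ = g _
    rw [mkT_smul_right]
    rfl

/-- The functor `M ⊗_R -`. -/
noncomputable def tensorFunctor : ModuleCat.{u} R ⥤ ModuleCat.{u} S where
  obj X := ModuleCat.of S (NCT R M X S)
  map {X X'} f := ModuleCat.ofHom (NCT.lift R M X S
    ((NCT.curry R M X' S LinearMap.id) ∘ₗ f.hom))
  map_id X := by
    ext z
    exact DFunLike.congr_fun (NCT.hom_ext (f := (NCT.lift R M X S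
      ((NCT.curry R M X S LinearMap.id) ∘ₗ LinearMap.id)).toAddMonoidHom)
      (g := AddMonoidHom.id _) fun _ _ => rfl) z
  map_comp {X X' X''} f g := by
    ext z
    exact DFunLike.congr_fun (NCT.hom_ext (f := (NCT.lift R M X S
      ((NCT.curry R M X'' S LinearMap.id) ∘ₗ (g.hom ∘ₗ f.hom))).toAddMonoidHom)
      (g := ((NCT.lift R M X' S ((NCT.curry R M X'' S LinearMap.id) ∘ₗ g.hom)) ∘ₗ
        (NCT.lift R M X S ((NCT.curry R M X' S LinearMap.id) ∘ₗ f.hom))).toAddMonoidHom)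
      fun _ _ => rfl) z

/-- The functor `Hom_S(M, -)`. -/
noncomputable def homFunctor : ModuleCat.{u} S ⥤ ModuleCat.{u} R where
  obj Y := ModuleCat.of R (M →ₗ[S] Y)
  map f := ModuleCat.ofHom
    { toFun := fun h => f.hom ∘ₗ h
      map_add' := fun _ _ => LinearMap.comp_add _ _ _
      map_smul' := fun _ _ => rfl }
  map_id _ := rfl
  map_comp _ _ := rfl

/-- The tensor-hom adjunction for the bimodule `M`. -/
noncomputable def tensorHomAdj : tensorFunctor R M S ⊣ homFunctor R M S :=
  Adjunction.mkOfHomEquiv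
    { homEquiv := fun X Y =>
        { toFun := fun g => ModuleCat.ofHom (NCT.curry R M X S g.hom)
          invFun := fun f => ModuleCat.ofHom (NCT.lift R M X S f.hom)
          left_inv := fun g => by
            ext z
            exact DFunLike.congr_fun (NCT.hom_ext
              (f := (NCT.lift R M X S (NCT.curry R M X S g.hom)).toAddMonoidHom)
              (g := g.hom.toAddMonoidHom) fun _ _ => rfl) z
          right_inv := fun f => rfl }
      homEquiv_naturality_left_symm := fun {X X' Y} f g => by
        ext z
        exact DFunLike.congr_fun (NCT.hom_ext
          (f := (NCT.lift R M X S (g.hom ∘ₗ f.hom)).toAddMonoidHom)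
          (g := (NCT.lift R M X' S g.hom ∘ₗ (NCT.lift R M X S
            ((NCT.curry R M X' S LinearMap.id) ∘ₗ f.hom))).toAddMonoidHom) fun _ _ => rfl) z
      homEquiv_naturality_right := fun f g => rfl }

instance homFunctor_additive : (homFunctor R M S).Additive where
  map_add {X Y f g} := by
    ext h
    exact LinearMap.add_comp _ _ _

end TensorHom

section DualPair

open CategoryTheory

/-- The `R`-`S`-bimodule `Q` is the `S`-dual of the `S`-`R`-bimodule `P`, which is finitely
generated projective over `S`. -/
structure IsDualPair (S R P Q : Type u) [Ring S] [Ring R] [AddCommGroup P] [AddCommGroup Q]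
    [Module S P] [Module Rᵐᵒᵖ P] [Module R Q] [Module Sᵐᵒᵖ Q] (β : Q →+ (P →ₗ[S] S)) : Prop where
  smul_left : ∀ (r : R) q p, β (r • q) p = β q (op r • p)
  smul_right : ∀ (s : S) q p, β (op s • q) p = β q p * s
  dual_basis : ∃ (n : ℕ) (p : Fin n → P) (q : Fin n → Q), (∀ x, ∑ i, β (q i) x • p i = x) ∧
    ∀ y, ∑ i, op (β y (p i)) • q i = y

variable {S R P Q : Type u} [Ring S] [Ring R] [AddCommGroup P] [AddCommGroup Q]
    [Module S P] [Module Rᵐᵒᵖ P] [Module R Q] [Module Sᵐᵒᵖ Q] {β : Q →+ (P →ₗ[S] S)}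
    [SMulCommClass Rᵐᵒᵖ S P] [SMulCommClass Sᵐᵒᵖ R Q]

/-- Evaluation `Q ⊗_S Y → Hom_S(P, Y)`. -/
noncomputable def IsDualPair.eval (h : IsDualPair S R P Q β) (Y : Type u) [AddCommGroup Y]
    [Module S Y] : NCT S Q Y R →ₗ[R] (P →ₗ[S] Y) :=
  NCT.lift S Q Y R
    { toFun := fun y =>
        { toFun := fun q => LinearMap.toSpanSingleton S Y y ∘ₗ β q
          map_add' := fun q q' => by rw [map_add, LinearMap.comp_add]
          map_smul' := fun r q => by
            ext p
            exact congrArg (· • y) (h.smul_left r q p) }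
      map_add' := fun y y' => by
        ext q p
        exact smul_add _ _ _
      map_smul' := fun s y => by
        ext q p
        change β q p • s • y = β (op s • q) p • y
        rw [h.smul_right, mul_smul] }

theorem IsDualPair.eval_mkT (h : IsDualPair S R P Q β) (Y : Type u) [AddCommGroup Y]
    [Module S Y] (q : Q) (y : Y) (p : P) : h.eval Y (mkT S Q Y R q y) p = β q p • y :=
  rfl

theorem IsDualPair.eval_bijective (h : IsDualPair S R P Q β) (Y : Type u) [AddCommGroup Y]
    [Module S Y] : Function.Bijective (h.eval Y) := by
  obtain ⟨n, p, q, hp, hq⟩ := h.dual_basis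
  let inv : (P →ₗ[S] Y) →+ NCT S Q Y R :=
    ∑ i, (mkTRight S Q Y R (q i)).comp (LinearMap.evalAddMonoidHom (p i))
  have hinv : ∀ f, inv f = ∑ i, mkT S Q Y R (q i) (f (p i)) := by
    intro f
    simp only [inv, AddMonoidHom.finsetSum_apply]
    rfl
  refine ⟨Function.LeftInverse.injective (g := inv) fun z => ?_,
    Function.RightInverse.surjective (g := inv) fun f => ?_⟩
  · refine DFunLike.congr_fun (NCT.hom_ext (f := inv.comp (h.eval Y).toAddMonoidHom)
      (g := AddMonoidHom.id _) fun q' y => ?_) z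
    change inv (h.eval Y (mkT S Q Y R q' y)) = mkT S Q Y R q' y
    simp only [hinv, h.eval_mkT, mkT_smul_right]
    conv_rhs => rw [← hq q']
    exact (map_sum (mkTLeft S Q Y R y) _ _).symm
  · ext x
    rw [hinv, map_sum, LinearMap.sum_apply]
    simp only [h.eval_mkT, ← map_smul]
    rw [← map_sum, hp]

variable [SMulCommClass S Rᵐᵒᵖ P] [SMulCommClass R Sᵐᵒᵖ Q]

/-- The functors `Q ⊗_S -` and `Hom_S(P, -)` are isomorphic. -/
noncomputable def IsDualPair.natIso (h : IsDualPair S R P Q β) :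
    tensorFunctor S Q R ≅ homFunctor R P S :=
  NatIso.ofComponents
    (fun Y => (LinearEquiv.ofBijective (h.eval Y) (h.eval_bijective Y)).toModuleIso)
    fun {Y Y'} f => by
      ext z
      refine DFunLike.congr_fun (NCT.hom_ext
        (f := ((h.eval Y') ∘ₗ ((tensorFunctor S Q R).map f).hom).toAddMonoidHom)
        (g := (((homFunctor R P S).map f).hom ∘ₗ (h.eval Y)).toAddMonoidHom) fun q y => ?_) z
      ext p
      exact (map_smul f.hom (β q p) y).symm

end DualPair
section StablyProjective

open CategoryTheory

variable (k : Type u) [Field k] {A : Type u} [Ring A] [Algebra k A]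

/-- The iterates of the Nakayama functor on objects, by structural recursion. -/
noncomputable def nakIter (V : ModuleCat.{u} A) : ℕ → ModuleCat.{u} A
  | 0 => V
  | i + 1 => nak k A (nakIter V i)

theorem nakIter_eq (V : ModuleCat.{u} A) (i : ℕ) : nakIter k V i = (nak k A)^[i] V := by
  induction i with
  | zero => rfl
  | succ i ih => rw [Function.iterate_succ_apply', ← ih]; rfl

theorem injective_nakMod (P : Type u) [AddCommGroup P] [Module A P] [Module.Finite A P]
    [Module.Projective A P] : Module.Injective A (NakMod k A P) where
  out X Y _ _ _ _ j hj f := by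
    obtain ⟨g, hg⟩ := nakMod_extend k j hj f
    exact ⟨g, fun x => LinearMap.congr_fun hg x⟩

theorem Module.Injective.of_sum_comp_eq_id {V : Type u} [AddCommGroup V] [Module A V]
    {ι : Type*} [Fintype ι] {W : ι → Type u} [∀ i, AddCommGroup (W i)] [∀ i, Module A (W i)]
    [∀ i, Module.Injective A (W i)] (f : ∀ i, V →ₗ[A] W i) (g : ∀ i, W i →ₗ[A] V)
    (h : ∑ i, g i ∘ₗ f i = LinearMap.id) : Module.Injective A V where
  out X Y _ _ _ _ j hj u := by
    choose v hv using fun i => Module.Injective.out j hj (f i ∘ₗ u)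
    refine ⟨∑ i, g i ∘ₗ v i, fun x => ?_⟩
    have := LinearMap.congr_fun h (u x)
    simpa [LinearMap.sum_apply, hv] using this

/-- An injective Artinian module cogenerated by `E` is a direct summand of a finite power of
`E`. -/
theorem SumFactor.of_iInf_ker_eq_bot {E X : Type u} [AddCommGroup E] [Module A E]
    [AddCommGroup X] [Module A X] [IsArtinian A X] [Module.Injective A X]
    (h : ⨅ f : X →ₗ[A] E, LinearMap.ker f = ⊥) : SumFactor A E X := by
  classical
  obtain ⟨s, hs⟩ := Finset.exists_inf_le fun f : X →ₗ[A] E => LinearMap.ker f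
  let F : X →ₗ[A] (s → E) := LinearMap.pi fun f => f.1
  have hF : Function.Injective F := by
    rw [← LinearMap.ker_eq_bot, eq_bot_iff, ← h]
    refine le_iInf fun f => le_trans ?_ (hs f)
    intro x hx
    rw [Finset.inf_eq_iInf, Submodule.mem_iInf]
    refine fun f => (Submodule.mem_iInf _).2 fun hf => ?_
    exact congr_fun (LinearMap.mem_ker.1 hx) ⟨f, hf⟩
  obtain ⟨r, hr⟩ := Module.Injective.out F hF (LinearMap.id : X →ₗ[A] X)
  refine SumFactor.of_fintype (ι := s) (fun f => f.1)
    (fun f => r ∘ₗ LinearMap.single A (fun _ : s => E) f) ?_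
  ext x
  simp only [LinearMap.sum_apply, LinearMap.comp_apply, ← map_sum]
  refine Eq.trans ?_ (hr x)
  congr 1
  exact Finset.univ_sum_single (F x)

variable [FiniteDimensional k A]

include k in
theorem isArtinian_of_finiteDimensional (X : Type*) [AddCommGroup X] [Module A X] [Module.Finite A X] :
    IsArtinian A X := by
  have : IsArtinianRing A := IsArtinianRing.of_finite k A
  infer_instance

theorem isStp_iff (V : ModuleCat.{u} A) : IsStp k A V ↔
    ∀ i, Module.Finite A (nakIter k V i) ∧ Module.Projective A (nakIter k V i) := by
  constructor
  · rintro ⟨hf, hp, h⟩ i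
    constructor
    · induction i with
      | zero => exact hf
      | succ i ih => exact finite_nakMod k (P := nakIter k V i)
    · cases i with
      | zero => exact hp
      | succ i => rw [nakIter_eq]; exact h _ i.succ_pos
  · intro h
    exact ⟨(h 0).1, (h 0).2, fun i _ => nakIter_eq k V i ▸ (h i).2⟩

/-- The trace ideals of the tails of the Nakayama orbit stabilise, so some member of the orbit is
a summand of a finite sum of later ones; fullness of the Nakayama functor on projectives then
moves this back to the start of the orbit. -/
theorem exists_sum_nakIter_comp_eq_id {V : ModuleCat.{u} A} (hV : IsStp k A V) :
    ∃ (ι : Type u) (_ : Fintype ι) (d : ι → ℕ) (f : ∀ t, V →ₗ[A] nakIter k V (d t + 1))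
      (g : ∀ t, nakIter k V (d t + 1) →ₗ[A] V), ∑ t, g t ∘ₗ f t = LinearMap.id := by
  rw [isStp_iff] at hV
  have hfin := fun i => (hV i).1
  have hproj := fun i => (hV i).2
  let T : ℕ → Submodule A A := fun j =>
    ⨆ i : {i // j ≤ i}, ⨆ φ : nakIter k V i →ₗ[A] A, LinearMap.range φ
  have hT : Antitone T := fun a b hab => iSup_le fun i =>
    le_iSup (fun i : {i // a ≤ i} => ⨆ φ : nakIter k V i →ₗ[A] A, LinearMap.range φ)
      ⟨i.1, hab.trans i.2⟩
  have : IsArtinian A A := isArtinian_of_finiteDimensional k A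
  obtain ⟨n, hn⟩ := IsArtinian.monotone_stabilizes (R := A) (M := A)
    ⟨fun j => OrderDual.toDual (T j), fun a b hab => hT hab⟩
  have hTn : T n = T (n + 1) := hn (n + 1) n.le_succ
  have start : ∃ (ι : Type u) (_ : Fintype ι) (e : ι → ℕ) (_ : ∀ t, n < e t)
      (f : ∀ t, nakIter k V n →ₗ[A] nakIter k V (e t))
      (g : ∀ t, nakIter k V (e t) →ₗ[A] nakIter k V n), ∑ t, g t ∘ₗ f t = LinearMap.id := by
    let J : Type u := Σ i : {i // n + 1 ≤ i}, (nakIter k V i →ₗ[A] nakIter k V n)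
    have hsup : ⨆ t : J, LinearMap.range t.2 = ⊤ := by
      rw [eq_top_iff]
      rintro x -
      obtain ⟨m, y, φ, hφ⟩ := exists_finite_dual_basis A (nakIter k V n)
      rw [← hφ x]
      refine Submodule.sum_mem _ fun i _ => ?_
      have h₁ : φ i x ∈ T n := Submodule.mem_iSup_of_mem ⟨n, le_rfl⟩
        (Submodule.mem_iSup_of_mem (φ i) ⟨x, rfl⟩)
      rw [hTn] at h₁
      have h₂ : T (n + 1) ≤ (⨆ t : J, LinearMap.range t.2).comap
          (LinearMap.toSpanSingleton A (nakIter k V n) (y i)) := by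
        refine iSup_le fun l => iSup_le fun ψ => ?_
        rintro _ ⟨w, rfl⟩
        exact Submodule.mem_iSup_of_mem
          (⟨l, LinearMap.toSpanSingleton A (nakIter k V n) (y i) ∘ₗ ψ⟩ : J) ⟨w, rfl⟩
      exact h₂ h₁
    obtain ⟨s, f, hf⟩ := exists_finset_sum_comp_eq_id (fun t : J => t.2) hsup
    refine ⟨s, inferInstance, fun t => t.1.1.1, fun t => t.1.1.2, fun t => f t, fun t => t.1.2, ?_⟩
    rw [← hf]
    exact Finset.sum_coe_sort s fun t => t.2 ∘ₗ f t
  have descend : ∀ j, j ≤ n → ∃ (ι : Type u) (_ : Fintype ι) (e : ι → ℕ) (_ : ∀ t, j < e t)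
      (f : ∀ t, nakIter k V j →ₗ[A] nakIter k V (e t))
      (g : ∀ t, nakIter k V (e t) →ₗ[A] nakIter k V j), ∑ t, g t ∘ₗ f t = LinearMap.id := by
    intro j hj
    induction hj using Nat.decreasingInduction with
    | self => exact start
    | of_succ j _ ih =>
      obtain ⟨ι, _, e, he, f, g, h⟩ := ih
      obtain ⟨d, rfl⟩ : ∃ d : ι → ℕ, e = fun t => d t + 1 :=
        ⟨fun t => e t - 1, funext fun t => (Nat.sub_add_cancel (Nat.one_le_of_lt (he t))).symm⟩
      choose f' hf' using fun t => exists_nakMap_eq k (P := nakIter k V j)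
        (Q := nakIter k V (d t)) (f t)
      choose g' hg' using fun t => exists_nakMap_eq k (P := nakIter k V (d t))
        (Q := nakIter k V j) (g t)
      refine ⟨ι, inferInstance, d, fun t => Nat.lt_of_succ_lt_succ (he t), f', g', ?_⟩
      apply nakMap_injective k
      rw [nakMap_sum, nakMap_id]
      refine Eq.trans (Finset.sum_congr rfl fun t _ => ?_) h
      rw [nakMap_comp, hf', hg']
      rfl
  obtain ⟨ι, _, e, he, f, g, h⟩ := descend 0 n.zero_le
  obtain ⟨d, rfl⟩ : ∃ d : ι → ℕ, e = fun t => d t + 1 :=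
    ⟨fun t => e t - 1, funext fun t => (Nat.sub_add_cancel (Nat.one_le_of_lt (he t))).symm⟩
  exact ⟨ι, inferInstance, d, f, g, h⟩

theorem IsStp.injective {V : ModuleCat.{u} A} (hV : IsStp k A V) : Module.Injective A V := by
  obtain ⟨ι, _, d, f, g, h⟩ := exists_sum_nakIter_comp_eq_id k hV
  rw [isStp_iff] at hV
  have : ∀ t, Module.Injective A (nakIter k V (d t + 1)) := fun t => by
    have := (hV (d t)).1
    have := (hV (d t)).2
    exact injective_nakMod k (nakIter k V (d t))
  exact Module.Injective.of_sum_comp_eq_id f g h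

theorem IsStp.of_sumFactor {V W : ModuleCat.{u} A} (hV : IsStp k A V) (h : SumFactor A V W) :
    IsStp k A W := by
  have key : ∀ i, SumFactor A (nakIter k V i) (nakIter k W i) := by
    intro i
    induction i with
    | zero => exact h
    | succ i ih => exact ih.nakMod k
  rw [isStp_iff] at hV ⊢
  intro i
  have := (hV i).1
  have := (hV i).2
  exact (key i).finite_projective

variable {B : Type u} [Ring B] [Algebra k B]
  {F : ModuleCat.{u} B ⥤ ModuleCat.{u} A} {G : ModuleCat.{u} A ⥤ ModuleCat.{u} B}

theorem SumFactor.map_functor {A : Type u} [Ring A] {B : Type u} [Ring B]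
    (F : ModuleCat.{u} B ⥤ ModuleCat.{u} A) [F.Additive] {Y W : ModuleCat.{u} B}
    (h : SumFactor B Y W) : SumFactor A (F.obj Y) (F.obj W) := by
  obtain ⟨n, f, g, h⟩ := h
  refine ⟨n, fun i => (F.map (ModuleCat.ofHom (f i))).hom,
    fun i => (F.map (ModuleCat.ofHom (g i))).hom, ?_⟩
  have h' : ∑ i, ModuleCat.ofHom (f i) ≫ ModuleCat.ofHom (g i) = 𝟙 W := by
    ext w
    have := LinearMap.congr_fun h w
    simpa [ModuleCat.hom_sum, LinearMap.sum_apply] using this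
  have h'' := congrArg F.map h'
  simp only [F.map_sum, F.map_comp, F.map_id] at h''
  have h₃ := congrArg ModuleCat.Hom.hom h''
  simpa [ModuleCat.hom_sum] using h₃

/-- If `F` and `G` are adjoint on both sides, then `ν F P` is a summand of a finite power of
`F ν P` for finitely generated projective `P`. -/
theorem sumFactor_nak_of_adj (adj₁ : F ⊣ G) (adj₂ : G ⊣ F) (P : ModuleCat.{u} B)
    [Module.Finite B P] [Module.Projective B P] [Module.Finite A (F.obj P)]
    [Module.Projective A (F.obj P)] :
    SumFactor A (F.obj (nak k B P)) (nak k A (F.obj P)) := by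
  let I := nak k A (F.obj P)
  let E := F.obj (nak k B P)
  have : Module.Injective A I := injective_nakMod k (F.obj P)
  have : Module.Finite A I := finite_nakMod k (P := F.obj P)
  have : IsArtinian A I := isArtinian_of_finiteDimensional k I
  refine SumFactor.of_iInf_ker_eq_bot (X := I) (E := E) ?_
  let K : Submodule A I := ⨅ f : I →ₗ[A] E, LinearMap.ker f
  let i : ModuleCat.of A K ⟶ I := ModuleCat.ofHom K.subtype
  have hi : Mono i := (ModuleCat.mono_iff_injective i).2 K.injective_subtype
  have := Functor.preservesMonomorphisms_of_adjunction adj₁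
  have hGi : Function.Injective (G.map i) :=
    (ModuleCat.mono_iff_injective _).1 inferInstance
  have h₁ : ∀ f : ModuleCat.of A K ⟶ E, f = 0 := by
    intro f
    obtain ⟨g, hg⟩ : ∃ g : G.obj I ⟶ nak k B P, G.map i ≫ g = (adj₂.homEquiv _ _).symm f := by
      obtain ⟨g, hg⟩ := nakMod_extend k (G.map i).hom hGi ((adj₂.homEquiv _ _).symm f).hom
      exact ⟨ModuleCat.ofHom g, ModuleCat.hom_ext hg⟩
    have hf : f = i ≫ adj₂.homEquiv _ _ g := by
      rw [← adj₂.homEquiv_naturality_left, hg, Equiv.apply_symm_apply]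
    ext x
    rw [hf]
    exact (Submodule.mem_iInf _).1 x.2 (adj₂.homEquiv _ _ g).hom
  have h₂ : ∀ f : G.obj (ModuleCat.of A K) ⟶ nak k B P, f = 0 := fun f =>
    (adj₂.homEquiv _ _).injective ((h₁ _).trans (h₁ _).symm)
  have h₃ : ∀ f : P ⟶ G.obj (ModuleCat.of A K), f = 0 := fun f =>
    ModuleCat.hom_ext (hom_eq_zero_of_hom_nakMod k
      (fun h => congrArg ModuleCat.Hom.hom (h₂ (ModuleCat.ofHom h))) f.hom)
  have h₄ : ∀ f : F.obj P ⟶ ModuleCat.of A K, f = 0 := fun f =>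
    (adj₁.homEquiv _ _).injective ((h₃ _).trans (h₃ _).symm)
  have h₅ : ∀ f : K →ₗ[A] NakMod k A (F.obj P), f = 0 :=
    hom_nakMod_eq_zero k (fun f => congrArg ModuleCat.Hom.hom (h₄ (ModuleCat.ofHom f)))
  rw [eq_bot_iff]
  exact fun x hx => LinearMap.congr_fun (h₅ K.subtype) ⟨x, hx⟩

variable [FiniteDimensional k B]

theorem IsStp.map_functor [F.Additive] (adj₁ : F ⊣ G) (adj₂ : G ⊣ F)
    (hF : ∀ Y : ModuleCat.{u} B, Module.Finite B Y → Module.Finite A (F.obj Y))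
    {P : ModuleCat.{u} B} (hP : IsStp k B P) : IsStp k A (F.obj P) := by
  rw [isStp_iff] at hP ⊢
  have hfp : ∀ i, Module.Finite A (F.obj (nakIter k P i)) ∧
      Module.Projective A (F.obj (nakIter k P i)) := by
    intro i
    have := Functor.preservesEpimorphisms_of_adjunction adj₂
    refine ⟨hF _ (hP i).1, ?_⟩
    rw [IsProjective.iff_projective]
    exact adj₁.map_projective _ ((IsProjective.iff_projective _).1 (hP i).2)
  have key : ∀ i, SumFactor A (F.obj (nakIter k P i)) (nakIter k (F.obj P) i) := by
    intro i
    induction i with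
    | zero => exact SumFactor.of_comp_eq_id LinearMap.id LinearMap.id rfl
    | succ i ih =>
      have := (hP i).1
      have := (hP i).2
      have := (hfp i).1
      have := (hfp i).2
      exact (sumFactor_nak_of_adj k adj₁ adj₂ (nakIter k P i)).trans (ih.nakMod k)
  intro i
  have := (hfp i).1
  have := (hfp i).2
  exact (key i).finite_projective

/-- Functors adjoint on both sides transport additive generators of the stably projective
modules. -/
theorem inAdd_map_iff_isStp [F.Additive] [G.Additive] (adj₁ : F ⊣ G) (adj₂ : G ⊣ F)
    (hF : ∀ Y : ModuleCat.{u} B, Module.Finite B Y → Module.Finite A (F.obj Y))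
    (hG : ∀ X : ModuleCat.{u} A, Module.Finite A X → Module.Finite B (G.obj X))
    (hmono : ∀ V : ModuleCat.{u} A, Module.Finite A V → Module.Projective A V →
      ∃ f : V →ₗ[A] F.obj (G.obj V), Function.Injective f)
    (Y : ModuleCat.{u} B) (hY : ∀ W, InAdd B Y W ↔ IsStp k B W) (V : ModuleCat.{u} A) :
    InAdd A (F.obj Y) V ↔ IsStp k A V := by
  constructor
  · intro h
    have hYs : IsStp k B Y := (hY Y).1 ((inAdd_iff_sumFactor _ _).2
      (SumFactor.of_comp_eq_id LinearMap.id LinearMap.id rfl))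
    exact (hYs.map_functor k adj₁ adj₂ hF).of_sumFactor k ((inAdd_iff_sumFactor _ _).1 h)
  · intro hV
    have hGV := (inAdd_iff_sumFactor _ _).1 ((hY _).2 (hV.map_functor k adj₂ adj₁ hG))
    obtain ⟨f, hf⟩ := hmono V hV.1 hV.2.1
    have := hV.injective k
    obtain ⟨r, hr⟩ := Module.Injective.out f hf (LinearMap.id : V →ₗ[A] V)
    exact (inAdd_iff_sumFactor _ _).2
      ((hGV.map_functor F).trans (SumFactor.of_comp_eq_id f r (LinearMap.ext hr)))

end StablyProjective
section FrobeniusPair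

open CategoryTheory

theorem NCT.curry_id_injective {S R M : Type u} [Ring S] [Ring R] [AddCommGroup M] [Module S M]
    [Module Rᵐᵒᵖ M] [SMulCommClass S Rᵐᵒᵖ M] [SMulCommClass Rᵐᵒᵖ S M]
    (hM : ∀ r : R, (∀ m : M, op r • m = 0) → r = 0) (V : Type u) [AddCommGroup V] [Module R V]
    [Module.Finite R V] [Module.Projective R V] :
    Function.Injective (NCT.curry R M V S (LinearMap.id : NCT R M V S →ₗ[S] _)) := by
  rw [injective_iff_map_eq_zero]
  intro v hv
  refine eq_zero_of_forall_dual_eq_zero (A := R) fun φ => hM _ fun m => ?_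
  let act : V →ₗ[R] (M →ₗ[S] M) :=
    { toFun := fun v => ract S R M (φ v)
      map_add' := fun v w => by
        ext m
        change op (φ (v + w)) • m = op (φ v) • m + op (φ w) • m
        rw [map_add, MulOpposite.op_add, add_smul]
      map_smul' := fun r v => by
        ext m
        change op (φ (r • v)) • m = op (φ v) • op r • m
        rw [map_smul, smul_eq_mul, MulOpposite.op_mul, mul_smul] }
  have hv' : mkT R M V S m v = 0 := LinearMap.congr_fun hv m
  exact (congrArg (NCT.lift R M V S act) hv').trans (map_zero _)

theorem IsDualPair.inAdd_tensor_iff_isStp (k : Type u) [Field k] {A B : Type u} [Ring A] [Ring B]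
    [Algebra k A] [Algebra k B] [FiniteDimensional k A] [FiniteDimensional k B]
    {M N : Type u} [AddCommGroup M] [AddCommGroup N] [Module B M] [Module Aᵐᵒᵖ M]
    [SMulCommClass B Aᵐᵒᵖ M] [SMulCommClass Aᵐᵒᵖ B M] [Module A N] [Module Bᵐᵒᵖ N]
    [SMulCommClass A Bᵐᵒᵖ N] [SMulCommClass Bᵐᵒᵖ A N]
    {β : N →+ (M →ₗ[B] B)} {γ : M →+ (N →ₗ[A] A)}
    (hβ : IsDualPair B A M N β) (hγ : IsDualPair A B N M γ)
    (hM : ∀ a : A, (∀ m : M, op a • m = 0) → a = 0)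
    [Module.Finite B M] [Module.Finite A N] (Y : ModuleCat.{u} B)
    (hY : ∀ W, InAdd B Y W ↔ IsStp k B W) (V : ModuleCat.{u} A) :
    InAdd A (ModuleCat.of A (NCT B N Y A)) V ↔ IsStp k A V := by
  have : (tensorFunctor B N A).Additive := Functor.additive_of_iso hβ.natIso.symm
  have : (tensorFunctor A M B).Additive := Functor.additive_of_iso hγ.natIso.symm
  refine inAdd_map_iff_isStp k (F := tensorFunctor B N A) (G := tensorFunctor A M B)
    ((tensorHomAdj B N A).ofNatIsoRight hγ.natIso.symm)
    ((tensorHomAdj A M B).ofNatIsoRight hβ.natIso.symm)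
    (fun Y _ => NCT.finite B N Y A) (fun X _ => NCT.finite A M X B) (fun V _ _ => ?_) Y hY V
  let e := LinearEquiv.ofBijective (hβ.eval (NCT A M V B)) (hβ.eval_bijective (NCT A M V B))
  exact ⟨e.symm.toLinearMap ∘ₗ NCT.curry A M V B LinearMap.id,
    e.symm.injective.comp (NCT.curry_id_injective hM V)⟩

variable {S R M : Type u} [Ring S] [Ring R] [AddCommGroup M] [Module S M]
    [Module Rᵐᵒᵖ M] [SMulCommClass Rᵐᵒᵖ S M]

theorem isDualPair_id [Module.Finite S M] [Module.Projective S M] :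
    IsDualPair S R M (M →ₗ[S] S) (AddMonoidHom.id _) where
  smul_left _ _ _ := rfl
  smul_right _ _ _ := rfl
  dual_basis := by
    obtain ⟨n, x, φ, h⟩ := exists_finite_dual_basis S M
    refine ⟨n, x, φ, h, fun ψ => ?_⟩
    ext m
    conv_rhs => rw [← h m, map_sum]
    simp [LinearMap.sum_apply]

variable [SMulCommClass S Rᵐᵒᵖ M]

/-- The pairing between `M` and `Hom_S(M, S)` with values in `R` given by an isomorphism
`Hom_S(M, S) ≅ Hom_{Rᵒᵖ}(M, R)`. -/
def frobeniusPairing (e : (M →ₗ[S] S) ≃+ (M →ₗ[Rᵐᵒᵖ] R))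
    (he : ∀ (r : R) (f : M →ₗ[S] S), e (f ∘ₗ ract S R M r) = mulLeft' R r ∘ₗ e f) :
    M →+ ((M →ₗ[S] S) →ₗ[R] R) where
  toFun m :=
    { toFun := fun f => e f m
      map_add' := fun f g => by rw [map_add]; rfl
      map_smul' := fun r f => LinearMap.congr_fun (he r f) m }
  map_zero' := by
    ext f
    exact map_zero (e f)
  map_add' m m' := by
    ext f
    exact map_add (e f) m m'

theorem isDualPair_frobeniusPairing [Module.Finite Rᵐᵒᵖ M] [Module.Projective Rᵐᵒᵖ M]
    (e : (M →ₗ[S] S) ≃+ (M →ₗ[Rᵐᵒᵖ] R))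
    (he : ∀ (r : R) (f : M →ₗ[S] S), e (f ∘ₗ ract S R M r) = mulLeft' R r ∘ₗ e f)
    (he' : ∀ (s : S) (f : M →ₗ[S] S),
      e (LinearMap.toSpanSingleton S S s ∘ₗ f) = e f ∘ₗ lact S R M s) :
    IsDualPair R S (M →ₗ[S] S) M (frobeniusPairing e he) where
  smul_left s m f := (LinearMap.congr_fun (he' s f) m).symm
  smul_right r m f := map_smul (e f) (op r) m
  dual_basis := by
    obtain ⟨n, x, φ, h⟩ := exists_finite_dual_basis Rᵐᵒᵖ M
    let μ : Fin n → M →ₗ[Rᵐᵒᵖ] R := fun i =>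
      { toFun := fun m => unop (φ i m)
        map_add' := fun m m' => by rw [map_add, MulOpposite.unop_add]
        map_smul' := fun r m => by rw [map_smul]; rfl }
    have hμ : ∀ m, ∑ i, op (μ i m) • x i = m := h
    refine ⟨n, fun i => e.symm (μ i), x, fun f => ?_, fun m => ?_⟩
    · apply e.injective
      rw [map_sum]
      ext m
      conv_rhs => rw [← hμ m, map_sum]
      rw [LinearMap.sum_apply]
      refine Finset.sum_congr rfl fun i _ => ?_
      refine (LinearMap.congr_fun (he _ _) m).trans ?_
      rw [AddEquiv.apply_symm_apply]
      exact (map_smul (e f) (op (μ i m)) (x i)).symm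
    · conv_rhs => rw [← hμ m]
      refine Finset.sum_congr rfl fun i _ => ?_
      change op (e (e.symm (μ i)) m) • x i = _
      rw [AddEquiv.apply_symm_apply]

theorem IsDualPair.finite {S R P Q : Type u} [Ring S] [Ring R] [AddCommGroup P] [AddCommGroup Q]
    [Module S P] [Module Rᵐᵒᵖ P] [Module R Q] [Module Sᵐᵒᵖ Q] {β : Q →+ (P →ₗ[S] S)}
    (h : IsDualPair S R P Q β) : Module.Finite S P := by
  obtain ⟨n, p, q, hp, -⟩ := h.dual_basis
  refine Module.Finite.of_surjective (Fintype.linearCombination S p) fun x =>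
    ⟨fun i => β (q i) x, hp x⟩

end FrobeniusPair

theorem stmt6 (k : Type u) [Field k]
    (A B : Type u) [Ring A] [Ring B] [Algebra k A] [Algebra k B]
    [FiniteDimensional k A] [FiniteDimensional k B]
    (M : Type u) [AddCommGroup M]
    [Module B M] [Module Aᵐᵒᵖ M] [SMulCommClass B Aᵐᵒᵖ M] [SMulCommClass Aᵐᵒᵖ B M]
    (hM : IsFrobeniusBimodule B A M) :
    ((∀ a : A, (∀ m : M, op a • m = 0) → a = 0) →
      ∀ (Y : Type u) (_ : AddCommGroup Y) (_ : Module B Y), Module.Finite B Y →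
        (∀ W : ModuleCat.{u} B, InAdd B (ModuleCat.of B Y) W ↔ IsStp k B W) →
        ∀ V : ModuleCat.{u} A,
          InAdd A (ModuleCat.of A (NCT B (M →ₗ[B] B) Y A)) V ↔ IsStp k A V) ∧
    ((∀ b : B, (∀ m : M, b • m = 0) → b = 0) →
      ∀ (X : Type u) (_ : AddCommGroup X) (_ : Module A X), Module.Finite A X →
        (∀ V : ModuleCat.{u} A, InAdd A (ModuleCat.of A X) V ↔ IsStp k A V) →
        ∀ W : ModuleCat.{u} B,
          InAdd B (ModuleCat.of B (NCT A M X B)) W ↔ IsStp k B W) := by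
  obtain ⟨hf, hp, hf', hp', e, he, he'⟩ := hM
  have hβ := isDualPair_id (S := B) (R := A) (M := M)
  have hγ := isDualPair_frobeniusPairing e he he'
  have := hγ.finite
  have : SMulCommClass A Bᵐᵒᵖ (M →ₗ[B] B) := ⟨fun _ _ _ => rfl⟩
  refine ⟨fun h Y _ _ _ hY V => hβ.inAdd_tensor_iff_isStp k hγ h (ModuleCat.of B Y) hY V,
    fun h X _ _ _ hX W => hγ.inAdd_tensor_iff_isStp k hβ (fun b hb => h b fun m => ?_)
      (ModuleCat.of A X) hX W⟩
  refine eq_zero_of_forall_dual_eq_zero (A := Aᵐᵒᵖ) fun φ => ?_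
  let μ : M →ₗ[Aᵐᵒᵖ] A :=
    { toFun := fun m => unop (φ m)
      map_add' := fun m m' => by rw [map_add, unop_add]
      map_smul' := fun r m => by rw [map_smul]; rfl }
  have h₁ := LinearMap.congr_fun (he' b (e.symm μ)) m
  rw [AddEquiv.apply_symm_apply] at h₁
  have h₂ : LinearMap.toSpanSingleton B B b ∘ₗ e.symm μ = 0 := hb (e.symm μ)
  rw [h₂, map_zero] at h₁
  exact unop_injective h₁.symm
end

section
/- Let B ⊆ A be a Frobenius extension of finite-dimensional algebras over a field k, let X be a finitely generated A-module with add(X) = A-stp, and let Y be a finitely generated B-module with add(Y) = B-stp. Then the canonical algebra homomorphisms End_A(X) → End_B(_B X) (restriction of scalars along B ⊆ A) and End_B(Y) → End_A(A ⊗_B Y) are injective and are Frobenius extensions. -/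
/-!
Statement 8: Let `B ⊆ A` be a Frobenius extension of finite-dimensional algebras over a
field `k`, `X` a finitely generated `A`-module with `add(X) = A`-stp and `Y` a finitely
generated `B`-module with `add(Y) = B`-stp.  Then the canonical algebra homomorphisms
`End_A(X) → End_B(X)` (restriction along `B ⊆ A`) and `End_B(Y) → End_A(A ⊗_B Y)` are
injective and are Frobenius extensions.
-/

universe u
open MulOpposite
section FrobeniusRingHom

variable {Γ Λ : Type u} [Ring Γ] [Ring Λ]

/-- A ring homomorphism `ι : Γ → Λ` is a Frobenius extension if `Λ`, regarded as a
`Γ`-bimodule via `ι`, is finitely generated projective as a left `Γ`-module and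
`Λ ≅ Hom_Γ(Λ, Γ)` as `Λ`-`Γ`-bimodules.  Here the left `Λ`-action on `Hom_Γ(Λ, Γ)` is
`(l • f) x = f (x * l)` and the right `Γ`-action is `(f • γ) x = f x * γ`, so the two
compatibilities below say exactly that the additive isomorphism `e` is an isomorphism of
`Λ`-`Γ`-bimodules. -/
def IsFrobeniusRingHom (ι : Γ →+* Λ) : Prop :=
  letI : Module Γ Λ := Module.compHom Λ ι
  Module.Finite Γ Λ ∧ Module.Projective Γ Λ ∧
  ∃ e : Λ ≃+ (Λ →ₗ[Γ] Γ),
    (∀ (l x y : Λ), e (l * x) y = e x (y * l)) ∧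
    (∀ (γ : Γ) (x y : Λ), e (x * ι γ) y = e x y * γ)

/-- `ι : Γ → Λ` is a split monomorphism of left `Γ`-modules, where `Λ` is a left
`Γ`-module via `ι`. -/
def IsLeftSplitRingHom (ι : Γ →+* Λ) : Prop :=
  ∃ π : Λ →+ Γ, (∀ (γ : Γ) (x : Λ), π (ι γ * x) = γ * π x) ∧ ∀ γ : Γ, π (ι γ) = γ

/-- `ι : Γ → Λ` is a split monomorphism of right `Γ`-modules, where `Λ` is a right
`Γ`-module via `ι`. -/
def IsRightSplitRingHom (ι : Γ →+* Λ) : Prop :=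
  ∃ π : Λ →+ Γ, (∀ (γ : Γ) (x : Λ), π (x * ι γ) = π x * γ) ∧ ∀ γ : Γ, π (ι γ) = γ

end FrobeniusRingHom

section FrobeniusSystem

variable {Γ Λ : Type u} [Ring Γ] [Ring Λ]

/-- A Frobenius homomorphism `E` for a ring homomorphism `ι`, with dual bases `x`, `y`. -/
structure FrobeniusSystem (ι : Γ →+* Λ) where
  /-- The number of elements of the dual bases. -/
  n : ℕ
  /-- The Frobenius homomorphism. -/
  E : Λ →+ Γ
  /-- The first dual basis. -/
  x : Fin n → Λ
  /-- The second dual basis. -/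
  y : Fin n → Λ
  E_left : ∀ γ l, E (ι γ * l) = γ * E l
  E_right : ∀ γ l, E (l * ι γ) = E l * γ
  sum_left : ∀ l, ∑ i, ι (E (l * x i)) * y i = l
  sum_right : ∀ l, ∑ i, x i * ι (E (y i * l)) = l

theorem FrobeniusSystem.isFrobeniusRingHom {ι : Γ →+* Λ} (s : FrobeniusSystem ι) :
    IsFrobeniusRingHom ι := by
  let : Module Γ Λ := Module.compHom Λ ι
  have hsm : ∀ (γ : Γ) (l : Λ), γ • l = ι γ * l := fun _ _ => rfl
  let f : Λ →ₗ[Γ] (Fin s.n → Γ) :=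
    { toFun := fun l i => s.E (l * s.x i)
      map_add' := fun a b => by ext i; simp [add_mul]
      map_smul' := fun c a => by ext i; simp [hsm, mul_assoc, s.E_left] }
  let g : (Fin s.n → Γ) →ₗ[Γ] Λ := Fintype.linearCombination Γ s.y
  have hgf : g ∘ₗ f = LinearMap.id := by
    ext l
    simp [f, g, Fintype.linearCombination_apply, hsm, s.sum_left]
  have hE : ∀ (φ : Λ →ₗ[Γ] Γ) (l : Λ), ∑ i, s.E (l * s.x i) * φ (s.y i) = φ l := by
    intro φ l
    conv_rhs => rw [← s.sum_left l, map_sum]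
    exact Finset.sum_congr rfl fun i _ => (φ.map_smul _ _).symm
  refine ⟨Module.Finite.of_surjective g fun l => ⟨f l, LinearMap.congr_fun hgf l⟩,
    Module.Projective.of_split f g hgf, ?_⟩
  refine ⟨{
    toFun := fun x =>
      { toFun := fun y => s.E (y * x)
        map_add' := fun a b => by simp [add_mul]
        map_smul' := fun c a => by simp [hsm, mul_assoc, s.E_left] }
    invFun := fun φ => ∑ i, s.x i * ι (φ (s.y i))
    left_inv := fun l => s.sum_right l
    right_inv := fun φ => by
      ext l
      simp only [LinearMap.coe_mk, AddHom.coe_mk, Finset.mul_sum, map_sum, ← mul_assoc,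
        s.E_right, hE]
    map_add' := fun a b => by ext l; simp [mul_add] }, ?_, ?_⟩
  · intro l x y
    simp [mul_assoc]
  · intro γ x y
    simp [← mul_assoc, s.E_right]

theorem IsFrobeniusRingHom.nonempty_frobeniusSystem {ι : Γ →+* Λ}
    (h : IsFrobeniusRingHom ι) : Nonempty (FrobeniusSystem ι) := by
  let : Module Γ Λ := Module.compHom Λ ι
  have hsm : ∀ (γ : Γ) (l : Λ), γ • l = ι γ * l := fun _ _ => rfl
  obtain ⟨hfin, hproj, e, he₁, he₂⟩ := h
  obtain ⟨n, f, hf⟩ := Module.Finite.exists_fin' Γ Λ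
  obtain ⟨g, hg⟩ := Module.projective_lifting_property f LinearMap.id hf
  have heE : ∀ l z, e l z = e 1 (z * l) := fun l z => by rw [← he₁, mul_one]
  have hE_left : ∀ γ l, e 1 (ι γ * l) = γ * e 1 l := fun γ l => (e 1).map_smul γ l
  have hE_right : ∀ γ l, e 1 (l * ι γ) = e 1 l * γ := fun γ l => by
    rw [← heE, ← he₂, one_mul]
  let x : Fin n → Λ := fun i => e.symm (LinearMap.proj i ∘ₗ g)
  let y : Fin n → Λ := fun i => f (Pi.single i 1)
  have hx : ∀ i l, e 1 (l * x i) = g l i := fun i l => by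
    rw [← heE]; simp [x]
  have hleft : ∀ l, ∑ i, ι (e 1 (l * x i)) * y i = l := by
    intro l
    have h1 : f (g l) = l := LinearMap.congr_fun hg l
    conv_rhs => rw [← h1, pi_eq_sum_univ' (g l), map_sum]
    refine Finset.sum_congr rfl fun i _ => ?_
    rw [hx, ← hsm, ← map_smul]
  refine ⟨⟨n, (e 1).toAddMonoidHom, x, y, hE_left, hE_right, hleft, ?_⟩⟩
  intro l
  apply e.injective
  ext z
  rw [heE, heE l]
  conv_rhs => rw [← hleft z]
  simp only [Finset.mul_sum, Finset.sum_mul, map_sum]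
  refine Finset.sum_congr rfl fun i _ => ?_
  change e 1 (z * (x i * ι (e 1 (y i * l)))) = _
  rw [← mul_assoc, hE_right, mul_assoc, hE_left]

theorem FrobeniusSystem.sum_E_x {ι : Γ →+* Λ} (s : FrobeniusSystem ι) :
    ∑ i, ι (s.E (s.x i)) * s.y i = 1 := by
  simpa using s.sum_left 1

theorem FrobeniusSystem.sum_E_y {ι : Γ →+* Λ} (s : FrobeniusSystem ι) :
    ∑ i, s.x i * ι (s.E (s.y i)) = 1 := by
  simpa using s.sum_right 1

/-- The trace of a `Γ`-linear map between `Λ`-modules is `Λ`-linear. -/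
def FrobeniusSystem.trace {ι : Γ →+* Λ} (s : FrobeniusSystem ι)
    {V W : Type u} [AddCommGroup V] [Module Λ V] [AddCommGroup W] [Module Λ W]
    (f : V →+ W) (hf : ∀ γ v, f (ι γ • v) = ι γ • f v) : V →ₗ[Λ] W where
  toFun v := ∑ i, s.x i • f (s.y i • v)
  map_add' v w := by simp [smul_add, Finset.sum_add_distrib]
  map_smul' a v := by
    have h1 : ∀ i, f (s.y i • a • v)
        = ∑ k, ι (s.E (s.y i * a * s.x k)) • f (s.y k • v) := by
      intro i
      rw [smul_smul, ← s.sum_left (s.y i * a), Finset.sum_smul, map_sum]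
      refine Finset.sum_congr rfl fun k _ => ?_
      rw [mul_smul, hf, s.sum_left]
    simp only [h1, Finset.smul_sum, RingHom.id_apply]
    rw [Finset.sum_comm]
    refine Finset.sum_congr rfl fun k _ => ?_
    simp only [smul_smul, ← Finset.sum_smul, mul_assoc]
    rw [s.sum_right]

end FrobeniusSystem

section Induced

variable {A B : Type u} [Ring A] [Ring B] {ι : B →+* A}

/-- Data exhibiting the `A`-module `Q` as induced from the `B`-module `P`: the unit `j` of
the adjunction between induction and restriction, and the counit `t` of the adjunction between
restriction and (co)induction. -/
structure Induced (s : FrobeniusSystem ι) (P Q : Type u) [AddCommGroup P] [Module B P]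
    [AddCommGroup Q] [Module A Q] where
  /-- The map `p ↦ 1 ⊗ p`. -/
  j : P →+ Q
  /-- The map `a ⊗ p ↦ E a • p`. -/
  t : Q →+ P
  j_smul : ∀ b p, j (b • p) = ι b • j p
  t_smul : ∀ b q, t (ι b • q) = b • t q
  t_j : ∀ a p, t (a • j p) = s.E a • p
  sum_j_t : ∀ q, ∑ i, s.x i • j (t (s.y i • q)) = q

variable {s : FrobeniusSystem ι} {P Q : Type u} [AddCommGroup P] [Module B P]
    [AddCommGroup Q] [Module A Q]

namespace Induced

/-- The `A`-linear map out of an induced module corresponding to a `B`-linear map. -/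
def lift (h : Induced s P Q) {V : Type u} [AddCommGroup V] [Module A V] (f : P →+ V)
    (hf : ∀ b p, f (b • p) = ι b • f p) : Q →ₗ[A] V :=
  s.trace (f.comp h.t) fun b q => by simp [h.t_smul, hf]

theorem lift_apply (h : Induced s P Q) {V : Type u} [AddCommGroup V] [Module A V]
    (f : P →+ V) (hf : ∀ b p, f (b • p) = ι b • f p) (q : Q) :
    h.lift f hf q = ∑ i, s.x i • f (h.t (s.y i • q)) := rfl

theorem lift_j (h : Induced s P Q) {V : Type u} [AddCommGroup V] [Module A V]
    (f : P →+ V) (hf : ∀ b p, f (b • p) = ι b • f p) (p : P) :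
    h.lift f hf (h.j p) = f p := by
  rw [lift_apply]
  simp only [h.t_j, hf, smul_smul, ← Finset.sum_smul, s.sum_E_y, one_smul]

theorem hom_ext (h : Induced s P Q) {V : Type u} [AddCommGroup V] [Module A V]
    {f g : Q →ₗ[A] V} (hfg : ∀ p, f (h.j p) = g (h.j p)) : f = g := by
  ext q
  rw [← h.sum_j_t q]
  simp [hfg]

theorem finite (h : Induced s P Q) [Module.Finite B P] : Module.Finite A Q := by
  classical
  obtain ⟨S, hS⟩ := (Module.Finite.fg_top : (⊤ : Submodule B P).FG)
  refine ⟨⟨S.image h.j, ?_⟩⟩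
  rw [Finset.coe_image]
  have hj : ∀ p : P, h.j p ∈ Submodule.span A (h.j '' S) := by
    intro p
    have hp : p ∈ Submodule.span B (S : Set P) := hS ▸ Submodule.mem_top
    induction hp using Submodule.span_induction with
    | mem p hp => exact Submodule.subset_span ⟨p, hp, rfl⟩
    | zero => simp
    | add a b _ _ ha hb => rw [map_add]; exact add_mem ha hb
    | smul b p _ hp => rw [h.j_smul]; exact Submodule.smul_mem _ _ hp
  rw [eq_top_iff]
  intro q _
  rw [← h.sum_j_t q]
  exact Submodule.sum_mem _ fun i _ => Submodule.smul_mem _ _ (hj _)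

theorem projective (h : Induced s P Q) [Module.Projective B P] : Module.Projective A Q := by
  refine Module.Projective.of_lifting_property'' fun f hf => ?_
  let : Module B (Q →₀ A) := Module.compHom (Q →₀ A) ι
  let : Module B Q := Module.compHom Q ι
  let f' : (Q →₀ A) →ₗ[B] Q :=
    { toFun := f, map_add' := f.map_add, map_smul' := fun b v => f.map_smul (ι b) v }
  let j' : P →ₗ[B] Q := { toFun := h.j, map_add' := h.j.map_add, map_smul' := h.j_smul }
  obtain ⟨g, hg⟩ := Module.projective_lifting_property f' j' hf
  refine ⟨h.lift g.toAddMonoidHom g.map_smul, h.hom_ext fun p => ?_⟩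
  refine (congrArg f (h.lift_j _ _ p)).trans ?_
  exact LinearMap.congr_fun hg p

theorem j_injective (h : Induced s P Q) [Module.Projective B P] (hι : Function.Injective ι) :
    Function.Injective h.j := by
  rw [injective_iff_map_eq_zero]
  intro p hp
  obtain ⟨g, hg⟩ := Module.projective_def'.1 (inferInstance : Module.Projective B P)
  have h0 : ∀ a, s.E a • p = 0 := fun a => by rw [← h.t_j, hp, smul_zero, map_zero]
  have h1 : g p = 0 := by
    ext z
    apply hι
    rw [← s.sum_right (ι (g p z))]
    have h2 : ∀ a, s.E a * g p z = 0 := fun a => by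
      rw [← smul_eq_mul, ← Finsupp.smul_apply, ← map_smul, h0]; simp
    simp [s.E_right, h2]
  have h3 := LinearMap.congr_fun hg p
  simpa [h1] using h3.symm

end Induced

/-- The module `A ⊗_B P` is induced from `P`. -/
noncomputable def inducedNCT (s : FrobeniusSystem ι) (P : Type u) [AddCommGroup P] [Module B P]
    [Module Bᵐᵒᵖ A] [SMulCommClass Bᵐᵒᵖ A A] (hsm : ∀ (b : B) (a : A), op b • a = a * ι b) :
    Induced s P (NCT B A P A) :=
  let t' : TensorProduct ℤ A P →+ P := TensorProduct.liftAddHom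
    (AddMonoidHom.mk' (fun a => AddMonoidHom.mk' (fun p => s.E a • p)
      fun p q => smul_add _ p q) fun a b => by ext p; simp [add_smul])
    fun r a p => by
      change s.E (r • a) • p = s.E a • r • p
      rw [map_zsmul, smul_assoc, smul_comm]
  have ht' : ∀ a p, t' (a ⊗ₜ p) = s.E a • p := fun a p => rfl
  have hbal : ∀ z ∈ balS B A P A, ∀ a : A, t' (a • z) = 0 := by
    intro z hz
    induction hz using Submodule.span_induction with
    | mem z hz =>
      obtain ⟨m, r, x, rfl⟩ := hz
      intro a
      rw [smul_sub, map_sub, TensorProduct.smul_tmul', TensorProduct.smul_tmul', ht', ht', hsm,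
        smul_eq_mul, smul_eq_mul, ← mul_assoc, s.E_right, mul_smul, sub_self]
    | zero => simp
    | add u v _ _ hu hv => intro a; rw [smul_add, map_add, hu, hv, add_zero]
    | smul c u _ hu => intro a; rw [smul_smul, hu]
  let t : NCT B A P A →+ P := QuotientAddGroup.lift (balS B A P A).toAddSubgroup t'
    fun z hz => by simpa using hbal z hz 1
  have ht : ∀ a p, t (mkT B A P A a p) = s.E a • p := fun a p => rfl
  have hadd : ∀ a p q, mkT B A P A a (p + q) = mkT B A P A a p + mkT B A P A a q := fun a p q =>
    congrArg (Submodule.Quotient.mk (p := balS B A P A)) (TensorProduct.tmul_add a p q)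
  have hsmul : ∀ c a p, c • mkT B A P A a p = mkT B A P A (c * a) p := fun c a p => rfl
  have hbal' : ∀ a b p, mkT B A P A a (b • p) = mkT B A P A (a * ι b) p := fun a b p => by
    rw [← hsm]
    exact (Submodule.Quotient.eq _).2 (Submodule.subset_span ⟨a, b, p, rfl⟩)
  have hind : ∀ (f g : NCT B A P A →+ NCT B A P A),
      (∀ a p, f (mkT B A P A a p) = g (mkT B A P A a p)) → f = g := fun f g hfg => by
    ext z
    obtain ⟨z, rfl⟩ := Submodule.Quotient.mk_surjective _ z
    induction z using TensorProduct.induction_on with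
    | zero => exact (map_zero f).trans (map_zero g).symm
    | tmul a p => exact hfg a p
    | add u v hu hv => exact (map_add f _ _).trans ((congrArg₂ _ hu hv).trans (map_add g _ _).symm)
  { j := AddMonoidHom.mk' (mkT B A P A 1) (hadd 1)
    t := t
    j_smul := fun b p => by simp [hbal', hsmul]
    t_smul := fun b q => by
      obtain ⟨q, rfl⟩ := Submodule.Quotient.mk_surjective _ q
      change t' (ι b • q) = b • t' q
      induction q using TensorProduct.induction_on with
      | zero => simp
      | tmul a p =>
        rw [TensorProduct.smul_tmul', ht', ht', smul_eq_mul, s.E_left, mul_smul]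
      | add u v hu hv => rw [smul_add, map_add, hu, hv, map_add, smul_add]
    t_j := fun a p => by
      change t (a • mkT B A P A 1 p) = _
      rw [hsmul, ht, mul_one]
    sum_j_t := fun q => by
      let f : NCT B A P A →+ NCT B A P A := AddMonoidHom.mk'
        (fun q => ∑ i, s.x i • mkT B A P A 1 (t (s.y i • q))) fun u v => by
          simp [hadd, Finset.sum_add_distrib]
      have hf : f = AddMonoidHom.id _ := by
        refine hind _ _ fun a p => ?_
        change ∑ i, s.x i • mkT B A P A 1 (t (s.y i • mkT B A P A a p)) = mkT B A P A a p
        simp only [hsmul, ht, hbal', one_mul]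
        have hone : ∀ a, mkT B A P A a p = a • mkT B A P A 1 p := fun a => by
          rw [hsmul, mul_one]
        rw [hone a]
        simp only [hone (s.x _ * _), ← Finset.sum_smul, s.sum_right]
      exact DFunLike.congr_fun hf q }

section Nak

variable {k : Type u} [Field k] [Algebra k A] [Algebra k B]

theorem FrobeniusSystem.E_smul (s : FrobeniusSystem ι)
    (hι : ∀ c : k, ι (algebraMap k B c) = algebraMap k A c) (c : k) (a : A) :
    s.E (c • a) = c • s.E a := by
  rw [Algebra.smul_def, ← hι, s.E_left, Algebra.smul_def]

/-- The map `φ ↦ E ∘ φ ∘ j` from `Hom_A(Q, A)` to `Hom_B(P, B)`, for a semilinear map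
`j : P → Q`. -/
def FrobeniusSystem.homDown (s : FrobeniusSystem ι)
    (hι : ∀ c : k, ι (algebraMap k B c) = algebraMap k A c)
    (j : P →+ Q) (hj : ∀ b p, j (b • p) = ι b • j p) : (Q →ₗ[A] A) →ₗ[k] (P →ₗ[B] B) where
  toFun φ :=
    { toFun := fun p => s.E (φ (j p))
      map_add' := by simp
      map_smul' := fun b p => by simp [hj, s.E_left] }
  map_add' φ ψ := by ext p; simp
  map_smul' c φ := by ext p; simp [s.E_smul hι]

/-- The map `ψ ↦ ∑ x i * ψ (t (y i • -))` from `Hom_B(P, B)` to `Hom_A(Q, A)`, for a semilinear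
map `t : Q → P`. -/
def FrobeniusSystem.homUp (s : FrobeniusSystem ι)
    (hι : ∀ c : k, ι (algebraMap k B c) = algebraMap k A c)
    (t : Q →+ P) (ht : ∀ b q, t (ι b • q) = b • t q) : (P →ₗ[B] B) →ₗ[k] (Q →ₗ[A] A) where
  toFun ψ := s.trace ((ι.toAddMonoidHom.comp ψ.toAddMonoidHom).comp t) fun b q => by simp [ht]
  map_add' φ ψ := by
    ext q
    simp [FrobeniusSystem.trace, mul_add, Finset.sum_add_distrib]
  map_smul' c φ := by
    ext q
    change ∑ i, s.x i * ι (c • φ (t (s.y i • q))) = c • ∑ i, s.x i * ι (φ (t (s.y i • q)))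
    rw [Finset.smul_sum]
    refine Finset.sum_congr rfl fun i _ => ?_
    rw [Algebra.smul_def, map_mul, hι, ← Algebra.smul_def, mul_smul_comm]

theorem FrobeniusSystem.homUp_apply (s : FrobeniusSystem ι)
    (hι : ∀ c : k, ι (algebraMap k B c) = algebraMap k A c)
    (t : Q →+ P) (ht : ∀ b q, t (ι b • q) = b • t q) (ψ : P →ₗ[B] B) (q : Q) :
    s.homUp hι t ht ψ q = ∑ i, s.x i * ι (ψ (t (s.y i • q))) := rfl

/-- The Nakayama functor commutes with induction along a Frobenius extension. -/
noncomputable def Induced.nakayama {P : ModuleCat.{u} B} {Q : ModuleCat.{u} A} (h : Induced s P Q)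
    (hι : ∀ c : k, ι (algebraMap k B c) = algebraMap k A c) :
    Induced s (nak k B P) (nak k A Q) where
  j := AddMonoidHom.mk'
    (fun p : (P →ₗ[B] B) →ₗ[k] k => (p ∘ₗ s.homDown hι h.j h.j_smul : (Q →ₗ[A] A) →ₗ[k] k))
    fun _ _ => rfl
  t := AddMonoidHom.mk'
    (fun q : (Q →ₗ[A] A) →ₗ[k] k => (q ∘ₗ s.homUp hι h.t h.t_smul : (P →ₗ[B] B) →ₗ[k] k))
    fun _ _ => rfl
  j_smul b (p : (P →ₗ[B] B) →ₗ[k] k) := by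
    refine LinearMap.ext fun φ : Q →ₗ[A] A => congrArg p ?_
    refine LinearMap.ext fun z => ?_
    exact (s.E_right b (φ (h.j z))).symm
  t_smul b (q : (Q →ₗ[A] A) →ₗ[k] k) := by
    refine LinearMap.ext fun ψ : P →ₗ[B] B => congrArg q ?_
    refine LinearMap.ext fun z => ?_
    change s.homUp hι h.t h.t_smul ψ z * ι b = ∑ i, s.x i * ι (ψ (h.t (s.y i • z)) * b)
    rw [s.homUp_apply, Finset.sum_mul]
    simp only [map_mul, mul_assoc]
  t_j a (p : (P →ₗ[B] B) →ₗ[k] k) := by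
    refine LinearMap.ext fun ψ : P →ₗ[B] B => congrArg p ?_
    refine LinearMap.ext fun z => ?_
    change s.E (s.homUp hι h.t h.t_smul ψ (h.j z) * a) = ψ z * s.E a
    rw [s.homUp_apply]
    simp only [h.t_j, map_smul, smul_eq_mul, map_mul, ← mul_assoc]
    rw [← Finset.sum_mul, s.sum_E_y, one_mul, s.E_left]
  sum_j_t (q : (Q →ₗ[A] A) →ₗ[k] k) := by
    refine LinearMap.ext fun φ : Q →ₗ[A] A => ?_
    have h1 : ∑ i, (fun l : Q →ₗ[A] A => (MulOpposite.op (s.y i) • l))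
        (s.homUp hι h.t h.t_smul (s.homDown hι h.j h.j_smul (MulOpposite.op (s.x i) • φ)))
        = φ := by
      refine LinearMap.ext fun z => ?_
      rw [LinearMap.sum_apply]
      change ∑ i, (∑ k, s.x k * ι (s.E (φ (h.j (h.t (s.y k • z))) * s.x i))) * s.y i = φ z
      simp only [Finset.sum_mul]
      rw [Finset.sum_comm]
      simp only [mul_assoc, ← Finset.mul_sum, s.sum_left]
      conv_rhs => rw [← h.sum_j_t z, map_sum]
      simp
    conv_rhs => rw [← h1, map_sum]
    exact LinearMap.sum_apply _ _ _

/-- The Nakayama functor commutes with restriction along a Frobenius extension. -/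
theorem FrobeniusSystem.nak_restrict (s : FrobeniusSystem ι)
    (hι : ∀ c : k, ι (algebraMap k B c) = algebraMap k A c)
    {P : ModuleCat.{u} B} {Q : ModuleCat.{u} A}
    (e : P ≃+ Q) (he : ∀ (b : B) (p : P), e (b • p) = ι b • e p) :
    ∃ e' : nak k B P ≃+ nak k A Q, ∀ (b : B) (p : nak k B P), e' (b • p) = ι b • e' p := by
  have he' : ∀ (b : B) (q : Q), e.symm (ι b • q) = b • e.symm q := fun b q => by
    rw [AddEquiv.symm_apply_eq, he, AddEquiv.apply_symm_apply]
  let α := s.homDown (k := k) hι e.toAddMonoidHom he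
  let β := s.homUp (k := k) hι e.symm.toAddMonoidHom he'
  have hβα : β ∘ₗ α = LinearMap.id := by
    refine LinearMap.ext fun φ => LinearMap.ext fun q => ?_
    change ∑ i, s.x i * ι (s.E (φ (e (e.symm (s.y i • q))))) = φ q
    simp [s.sum_right]
  have hαβ : α ∘ₗ β = LinearMap.id := by
    refine LinearMap.ext fun ψ => LinearMap.ext fun p => ?_
    change s.E (∑ i, s.x i * ι (ψ (e.symm (s.y i • e p)))) = ψ p
    simp only [map_sum, s.E_right]
    have h1 : ∀ i, s.E (s.x i) * ψ (e.symm (s.y i • e p))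
        = ψ (e.symm ((ι (s.E (s.x i)) * s.y i) • e p)) := fun i => by
      rw [mul_smul, he', map_smul ψ, smul_eq_mul]
    simp only [h1]
    rw [← map_sum, ← map_sum, ← Finset.sum_smul, s.sum_E_x, one_smul, e.symm_apply_apply]
  refine ⟨{
    toFun := fun p : (P →ₗ[B] B) →ₗ[k] k => (p ∘ₗ α : (Q →ₗ[A] A) →ₗ[k] k)
    invFun := fun q : (Q →ₗ[A] A) →ₗ[k] k => (q ∘ₗ β : (P →ₗ[B] B) →ₗ[k] k)
    left_inv := fun p : (P →ₗ[B] B) →ₗ[k] k =>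
      LinearMap.ext fun ψ => congrArg p (LinearMap.congr_fun hαβ ψ)
    right_inv := fun q : (Q →ₗ[A] A) →ₗ[k] k =>
      LinearMap.ext fun φ => congrArg q (LinearMap.congr_fun hβα φ)
    map_add' := fun _ _ => rfl }, fun b (p : (P →ₗ[B] B) →ₗ[k] k) => ?_⟩
  refine LinearMap.ext fun φ : Q →ₗ[A] A => congrArg p ?_
  refine LinearMap.ext fun z => ?_
  exact (s.E_right b (φ (e z))).symm

theorem FrobeniusSystem.projective_restrict (s : FrobeniusSystem ι) (e : P ≃+ Q)
    (he : ∀ (b : B) (p : P), e (b • p) = ι b • e p) [Module.Projective A Q] :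
    Module.Projective B P := by
  have he' : ∀ (b : B) (q : Q), e.symm (ι b • q) = b • e.symm q := fun b q => by
    rw [AddEquiv.symm_apply_eq, he, AddEquiv.apply_symm_apply]
  obtain ⟨g, hg⟩ := Module.projective_def'.1 (inferInstance : Module.Projective A Q)
  let : Module B A := Module.compHom A ι
  have : Module.Projective B A := s.isFrobeniusRingHom.2.1
  classical
  have : Module.Projective B (Q →₀ A) :=
    Module.Projective.of_equiv (finsuppLequivDFinsupp (ι := Q) (M := A) B).symm
  let g' : P →ₗ[B] (Q →₀ A) :=
    { toFun := fun p => g (e p)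
      map_add' := by simp
      map_smul' := fun b p => by rw [he, map_smul]; rfl }
  let f' : (Q →₀ A) →ₗ[B] P :=
    { toFun := fun v => e.symm (Finsupp.linearCombination A id v)
      map_add' := by simp
      map_smul' := fun b v => by
        rw [RingHom.id_apply, ← he', ← map_smul]; rfl }
  refine Module.Projective.of_split g' f' (LinearMap.ext fun p => ?_)
  exact (congrArg e.symm (LinearMap.congr_fun hg (e p))).trans (e.symm_apply_apply p)

theorem FrobeniusSystem.finite_restrict (s : FrobeniusSystem ι) (e : P ≃+ Q)
    (he : ∀ (b : B) (p : P), e (b • p) = ι b • e p) [Module.Finite A Q] :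
    Module.Finite B P := by
  have he' : ∀ (b : B) (q : Q), e.symm (ι b • q) = b • e.symm q := fun b q => by
    rw [AddEquiv.symm_apply_eq, he, AddEquiv.apply_symm_apply]
  obtain ⟨n, f, hf⟩ := Module.Finite.exists_fin' A Q
  let : Module B A := Module.compHom A ι
  have : Module.Finite B A := s.isFrobeniusRingHom.1
  let f' : (Fin n → A) →ₗ[B] P :=
    { toFun := fun v => e.symm (f v)
      map_add' := by simp
      map_smul' := fun b v => by
        rw [RingHom.id_apply, ← he', ← map_smul]; rfl }
  exact Module.Finite.of_surjective f' (e.symm.surjective.comp hf)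

theorem Induced.isStp {P : ModuleCat.{u} B} {Q : ModuleCat.{u} A} (h : Induced s P Q)
    (hι : ∀ c : k, ι (algebraMap k B c) = algebraMap k A c) (hP : IsStp k B P) :
    IsStp k A Q := by
  obtain ⟨h1, h2, h3⟩ := hP
  refine ⟨h.finite, h.projective, fun i hi => ?_⟩
  have hind : ∀ i : ℕ, Nonempty (Induced s ((nak k B)^[i] P) ((nak k A)^[i] Q)) := by
    intro i
    induction i with
    | zero => exact ⟨h⟩
    | succ i ih =>
      obtain ⟨h⟩ := ih
      rw [Function.iterate_succ_apply', Function.iterate_succ_apply']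
      exact ⟨h.nakayama hι⟩
  have := h3 i hi
  exact (hind i).some.projective

theorem FrobeniusSystem.isStp_restrict (s : FrobeniusSystem ι)
    (hι : ∀ c : k, ι (algebraMap k B c) = algebraMap k A c)
    {P : ModuleCat.{u} B} {Q : ModuleCat.{u} A}
    (e : P ≃+ Q) (he : ∀ (b : B) (p : P), e (b • p) = ι b • e p) (hQ : IsStp k A Q) :
    IsStp k B P := by
  obtain ⟨h1, h2, h3⟩ := hQ
  refine ⟨s.finite_restrict e he, s.projective_restrict e he, fun i hi => ?_⟩
  have hind : ∀ i : ℕ, ∃ e' : (nak k B)^[i] P ≃+ (nak k A)^[i] Q,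
      ∀ (b : B) (p : (nak k B)^[i] P), e' (b • p) = ι b • e' p := by
    intro i
    induction i with
    | zero => exact ⟨e, he⟩
    | succ i ih =>
      obtain ⟨e', he'⟩ := ih
      rw [Function.iterate_succ_apply', Function.iterate_succ_apply']
      exact s.nak_restrict hι e' he'
  have := h3 i hi
  obtain ⟨e', he'⟩ := hind i
  exact s.projective_restrict e' he'

end Nak

theorem inAdd_self (R : Type u) [Ring R] (V : ModuleCat.{u} R) : InAdd R V V :=
  ⟨1, LinearMap.pi fun _ => LinearMap.id, LinearMap.proj 0, rfl⟩

theorem InAdd.exists_sum {R : Type u} [Ring R] {V W : Type u} [AddCommGroup V] [Module R V]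
    [AddCommGroup W] [Module R W] (h : InAdd R (ModuleCat.of R V) (ModuleCat.of R W)) :
    ∃ (n : ℕ) (p : Fin n → W →ₗ[R] V) (q : Fin n → V →ₗ[R] W), ∀ w, ∑ i, q i (p i w) = w := by
  obtain ⟨n, f, g, hgf⟩ := h
  let f' : W →ₗ[R] (Fin n → V) := f
  let g' : (Fin n → V) →ₗ[R] W := g
  refine ⟨n, fun i => LinearMap.proj i ∘ₗ f', fun i => g' ∘ₗ LinearMap.single R (fun _ => V) i,
    fun w => ?_⟩
  simp only [LinearMap.comp_apply, ← map_sum, LinearMap.proj_apply, LinearMap.coe_single,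
    Finset.univ_sum_single]
  exact LinearMap.congr_fun hgf w

/-- Restriction `End_A(X) → End_B(X)` is a Frobenius extension if the module induced from the
restriction of `X` lies in `add X`. -/
theorem Induced.isFrobeniusRingHom_restrict {X : Type u} [AddCommGroup X] [Module A X]
    [Module B X] (hBX : ∀ (b : B) (x : X), b • x = ι b • x) (h : Induced s X Q)
    (hadd : InAdd A (ModuleCat.of A X) (ModuleCat.of A Q))
    (Φ : Module.End A X →+* Module.End B X) (hΦ : ∀ f x, Φ f x = f x) :
    IsFrobeniusRingHom Φ := by
  obtain ⟨n, p, q, hpq⟩ := hadd.exists_sum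
  have hlin : ∀ (f : Module.End B X) (b : B) (x : X), f (ι b • x) = ι b • f x := fun f b x => by
    rw [← hBX, map_smul, hBX]
  let T : Module.End B X →+ Module.End A X := AddMonoidHom.mk'
    (fun f => s.trace f.toAddMonoidHom (hlin f)) fun f g => by
      ext x; simp [FrobeniusSystem.trace, Finset.sum_add_distrib]
  have hT : ∀ f x, T f x = ∑ i, s.x i • f (s.y i • x) := fun f x => rfl
  let v : Fin n → Module.End B X := fun i =>
    { toFun := fun x => p i (h.j x)
      map_add' := by simp
      map_smul' := fun b x => by rw [RingHom.id_apply, h.j_smul, map_smul, hBX] }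
  let u : Fin n → Module.End B X := fun i =>
    { toFun := fun x => h.t (q i x)
      map_add' := by simp
      map_smul' := fun b x => by simp [h.t_smul, hBX b x] }
  have hv : ∀ i x, v i x = p i (h.j x) := fun _ _ => rfl
  have hu : ∀ i x, u i x = h.t (q i x) := fun _ _ => rfl
  refine FrobeniusSystem.isFrobeniusRingHom ⟨n, T, u, v, fun γ l => ?_, fun γ l => ?_,
    fun l => ?_, fun l => ?_⟩
  · ext x
    simp [hT, hΦ]
  · ext x
    simp [hT, hΦ]
  · ext x
    have h1 : ∀ i, T (l * u i) (v i x)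
        = h.lift l.toAddMonoidHom (fun b x => (l.map_smul b x).trans (hBX b _))
          (q i (p i (h.j x))) := fun i => by
      rw [hT, hv]
      simp only [Module.End.mul_apply, hu, map_smul]
      rfl
    simp only [LinearMap.sum_apply, Module.End.mul_apply, hΦ] at h1 ⊢
    simp only [h1, ← map_sum, hpq]
    exact h.lift_j _ _ x
  · ext x
    simp only [LinearMap.sum_apply, Module.End.mul_apply, hΦ, hT, hu, hv, map_sum, map_smul]
    rw [Finset.sum_comm]
    simp only [← map_sum, ← Finset.smul_sum, hpq]
    simp only [map_sum, h.t_j, ← map_smul]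
    rw [← map_sum]
    congr 1
    simp only [hBX, smul_smul, ← Finset.sum_smul, s.sum_E_x, one_smul]

/-- The `A`-linear endomorphism of an induced module `Q` given by an endomorphism of `P`. -/
def Induced.endMap (h : Induced s P Q) (g : Module.End B P) : Module.End A Q :=
  h.lift (h.j.comp g.toAddMonoidHom) fun b p =>
    (congrArg h.j (g.map_smul b p)).trans (h.j_smul b (g p))

theorem Induced.endMap_j (h : Induced s P Q) (g : Module.End B P) (p : P) :
    h.endMap g (h.j p) = h.j (g p) := h.lift_j _ _ p

/-- The ring homomorphism `End_B(P) → End_A(Q)` for an induced module `Q`. -/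
def Induced.endHom (h : Induced s P Q) : Module.End B P →+* Module.End A Q where
  toFun := h.endMap
  map_one' := h.hom_ext fun p => h.endMap_j 1 p
  map_mul' f g := h.hom_ext fun p => by simp only [Module.End.mul_apply, h.endMap_j]
  map_zero' := h.hom_ext fun p => (h.endMap_j 0 p).trans (map_zero h.j)
  map_add' f g := h.hom_ext fun p => by simp only [LinearMap.add_apply, h.endMap_j, map_add]

theorem Induced.endHom_j (h : Induced s P Q) (g : Module.End B P) (p : P) :
    h.endHom g (h.j p) = h.j (g p) := h.endMap_j g p

theorem Induced.endHom_injective (h : Induced s P Q) (hj : Function.Injective h.j) :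
    Function.Injective h.endHom := fun f g hfg => by
  ext p
  apply hj
  rw [← h.endHom_j, hfg, h.endHom_j]

/-- Induction `End_B(P) → End_A(Q)` is a Frobenius extension if the restriction of the induced
module `Q` lies in `add P`. -/
theorem Induced.isFrobeniusRingHom_endHom (h : Induced s P Q) [Module B Q]
    (hBQ : ∀ (b : B) (q : Q), b • q = ι b • q)
    (hadd : InAdd B (ModuleCat.of B P) (ModuleCat.of B Q)) :
    IsFrobeniusRingHom h.endHom := by
  obtain ⟨n, p, q, hpq⟩ := hadd.exists_sum
  let T : Module.End A Q →+ Module.End B P := AddMonoidHom.mk'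
    (fun f =>
      { toFun := fun x => h.t (f (h.j x))
        map_add' := by simp
        map_smul' := fun b x => by simp [h.j_smul, h.t_smul] })
    fun f g => by ext x; simp
  have hT : ∀ f x, T f x = h.t (f (h.j x)) := fun f x => rfl
  have hp : ∀ i b z, p i (ι b • z) = b • p i z := fun i b z => by rw [← hBQ, map_smul]
  let v : Fin n → Module.End A Q := fun i =>
    s.trace (h.j.comp (p i).toAddMonoidHom) fun b z => by simp [hp, h.j_smul]
  have hv : ∀ i z, v i z = ∑ k, s.x k • h.j (p i (s.y k • z)) := fun _ _ => rfl
  let u : Fin n → Module.End A Q := fun i =>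
    h.lift (q i).toAddMonoidHom fun b x => ((q i).map_smul b x).trans (hBQ b _)
  have hu : ∀ i x, u i (h.j x) = q i x := fun i x => h.lift_j _ _ x
  have htv : ∀ i z, h.t (v i z) = p i z := fun i z => by
    simp only [hv, map_sum, h.t_j, ← hp, smul_smul]
    rw [← map_sum, ← Finset.sum_smul, s.sum_E_x, one_smul]
  refine FrobeniusSystem.isFrobeniusRingHom ⟨n, T, u, v, fun γ l => ?_, fun γ l => ?_,
    fun l => ?_, fun l => ?_⟩
  · ext x
    have ht : ∀ z, h.t (h.endHom γ z) = γ (h.t z) := fun z => by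
      conv_lhs => rw [← h.sum_j_t z]
      simp only [map_sum, map_smul, h.endHom_j, h.t_j]
      simp only [← map_smul, ← h.t_smul, smul_smul]
      rw [← map_sum, ← map_sum, ← Finset.sum_smul, s.sum_E_x, one_smul]
    simp [hT, ht]
  · ext x
    simp [hT, h.endHom_j]
  · ext z
    simp only [LinearMap.sum_apply, Module.End.mul_apply, hv, map_sum, map_smul, h.endHom_j, hT,
      hu]
    rw [Finset.sum_comm]
    simp only [← map_sum, ← Finset.smul_sum, hpq]
    simp only [map_smul, h.sum_j_t]
  · refine h.hom_ext fun x => ?_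
    simp only [LinearMap.sum_apply, Module.End.mul_apply, h.endHom_j, hT, hu, htv, hpq]

/-- The restriction map `End_A(X) → End_B(X)`. -/
def endRestrict {X : Type u} [AddCommGroup X] [Module A X] [Module B X]
    (hBX : ∀ (b : B) (x : X), b • x = ι b • x) : Module.End A X →+* Module.End B X where
  toFun f :=
    { toFun := f
      map_add' := f.map_add
      map_smul' := fun b x => by rw [hBX, map_smul, RingHom.id_apply, hBX] }
  map_one' := rfl
  map_mul' _ _ := rfl
  map_zero' := rfl
  map_add' _ _ := rfl

variable {k : Type u} [Field k] [Algebra k A] [Algebra k B] [Module Bᵐᵒᵖ A]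
  [SMulCommClass Bᵐᵒᵖ A A]

theorem FrobeniusSystem.isFrobeniusRingHom_endRestrict (s : FrobeniusSystem ι)
    (hι : ∀ c : k, ι (algebraMap k B c) = algebraMap k A c)
    (hsm : ∀ (b : B) (a : A), op b • a = a * ι b)
    {X : Type u} [AddCommGroup X] [Module A X] [Module B X]
    (hBX : ∀ (b : B) (x : X), b • x = ι b • x)
    (hX : ∀ V : ModuleCat.{u} A, InAdd A (ModuleCat.of A X) V ↔ IsStp k A V) :
    IsFrobeniusRingHom (endRestrict hBX) := by
  have hres : IsStp k B (ModuleCat.of B X) :=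
    s.isStp_restrict hι (Q := ModuleCat.of A X) (AddEquiv.refl X) hBX ((hX _).1 (inAdd_self A _))
  let h := inducedNCT s X hsm
  have hind : IsStp k A (ModuleCat.of A (NCT B A X A)) :=
    Induced.isStp (P := ModuleCat.of B X) h hι hres
  exact h.isFrobeniusRingHom_restrict hBX ((hX _).2 hind) _ fun _ _ => rfl

theorem FrobeniusSystem.isFrobeniusRingHom_endHom (s : FrobeniusSystem ι)
    (hι : ∀ c : k, ι (algebraMap k B c) = algebraMap k A c)
    (hsm : ∀ (b : B) (a : A), op b • a = a * ι b)
    {Y : Type u} [AddCommGroup Y] [Module B Y]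
    (hY : ∀ W : ModuleCat.{u} B, InAdd B (ModuleCat.of B Y) W ↔ IsStp k B W) :
    IsFrobeniusRingHom (inducedNCT s Y hsm).endHom := by
  let h := inducedNCT s Y hsm
  have hind : IsStp k A (ModuleCat.of A (NCT B A Y A)) :=
    Induced.isStp (P := ModuleCat.of B Y) h hι ((hY _).1 (inAdd_self B _))
  let : Module B (NCT B A Y A) := Module.compHom _ ι
  have hres : IsStp k B (ModuleCat.of B (NCT B A Y A)) :=
    s.isStp_restrict hι (Q := ModuleCat.of A (NCT B A Y A)) (AddEquiv.refl _)
      (fun _ _ => rfl) hind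
  exact h.isFrobeniusRingHom_endHom (fun _ _ => rfl) ((hY _).2 hres)

theorem inducedNCT_endHom_mkT (s : FrobeniusSystem ι)
    (hsm : ∀ (b : B) (a : A), op b • a = a * ι b) {Y : Type u} [AddCommGroup Y] [Module B Y]
    (g : Module.End B Y) (a : A) (y : Y) :
    (inducedNCT s Y hsm).endHom g (mkT B A Y A a y) = mkT B A Y A a (g y) := by
  have h1 : ∀ y, mkT B A Y A a y = a • (inducedNCT s Y hsm).j y := fun y => by
    change _ = mkT B A Y A (a * 1) y
    rw [mul_one]
  rw [h1, h1, map_smul, Induced.endHom_j]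

end Induced

theorem stmt8 (k : Type u) [Field k]
    (A B : Type u) [Ring A] [Ring B] [Algebra k A] [Algebra k B]
    [FiniteDimensional k A] [FiniteDimensional k B]
    (ι : B →ₐ[k] A) (hinj : Function.Injective ι)
    (hfrob : IsFrobeniusRingHom ι.toRingHom)
    (X : Type u) [AddCommGroup X] [Module A X] [Module.Finite A X]
    (hX : ∀ V : ModuleCat.{u} A, InAdd A (ModuleCat.of A X) V ↔ IsStp k A V)
    (Y : Type u) [AddCommGroup Y] [Module B Y] [Module.Finite B Y]
    (hY : ∀ W : ModuleCat.{u} B, InAdd B (ModuleCat.of B Y) W ↔ IsStp k B W) :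
    letI : Module B X := Module.compHom X ι.toRingHom
    letI : Module Bᵐᵒᵖ A := Module.compHom A (RingHom.op ι.toRingHom)
    haveI : SMulCommClass Bᵐᵒᵖ A A :=
      ⟨fun b a x => mul_assoc a x (ι (unop b))⟩
    (∃ Φ₁ : Module.End A X →+* Module.End B X,
      (∀ (f : Module.End A X) (x : X), Φ₁ f x = f x) ∧
      Function.Injective Φ₁ ∧ IsFrobeniusRingHom Φ₁) ∧
    (∃ Φ₂ : Module.End B Y →+* Module.End A (NCT B A Y A),
      (∀ (g : Module.End B Y) (a : A) (y : Y),
        Φ₂ g (mkT B A Y A a y) = mkT B A Y A a (g y)) ∧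
      Function.Injective Φ₂ ∧ IsFrobeniusRingHom Φ₂) := by
  obtain ⟨s⟩ := hfrob.nonempty_frobeniusSystem
  have hι : ∀ c : k, ι.toRingHom (algebraMap k B c) = algebraMap k A c := ι.commutes
  let : Module B X := Module.compHom X ι.toRingHom
  let : Module Bᵐᵒᵖ A := Module.compHom A (RingHom.op ι.toRingHom)
  have : SMulCommClass Bᵐᵒᵖ A A := ⟨fun b a x => mul_assoc a x (ι (unop b))⟩
  have hBX : ∀ (b : B) (x : X), b • x = ι.toRingHom b • x := fun _ _ => rfl
  have hsm : ∀ (b : B) (a : A), op b • a = a * ι.toRingHom b := fun _ _ => rfl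
  have : Module.Projective B Y := ((hY _).1 (inAdd_self B _)).2.1
  exact ⟨⟨endRestrict hBX, fun _ _ => rfl,
      fun f g hfg => LinearMap.ext fun x => LinearMap.congr_fun hfg x,
      s.isFrobeniusRingHom_endRestrict hι hsm hBX hX⟩,
    ⟨(inducedNCT s Y hsm).endHom, inducedNCT_endHom_mkT s hsm,
      (inducedNCT s Y hsm).endHom_injective ((inducedNCT s Y hsm).j_injective hinj),
      s.isFrobeniusRingHom_endHom hι hsm hY⟩⟩
end
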